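/- arXiv:0705.3839 — 3 statements merged into one kernel-verified Lean document; each statement's English description precedes it below -/
import Mathlib

section
/- Let (V,b) and (V',b') be isometric nonsingular finite-dimensional metric spaces over F. Let subspaces E, A ⊆ V and E', A' ⊆ V' satisfy A ≈ A', and let φ : E → E' be an isometry. Then φ can be extended to an isometry φ_V : V → V' that sends A to A' if and only if: φ(E ∩ (A+A^⊥)) = E' ∩ (A'+A'^⊥), φ(E ∩ A) = E' ∩ A', φ(E ∩ A^⊥) = E' ∩ A'^⊥, and the induced linear bijection φ_A (equivalently, φ_{A^⊥}) is an isometry with respect to the induced forms on the quotients. -/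
open Module

namespace Witt

variable {F V V' : Type*} [Field F] [AddCommGroup V] [Module F V]
  [AddCommGroup V'] [Module F V']

/-- A linear equivalence `φ : E ≃ E'` between subspaces is an isometry if it
preserves the ambient bilinear forms. -/
def IsIsometryOn (B : LinearMap.BilinForm F V) (B' : LinearMap.BilinForm F V')
    (E : Submodule F V) (E' : Submodule F V') (φ : E ≃ₗ[F] E') : Prop :=
  ∀ u v : E, B' (φ u : V') (φ v : V') = B (u : V) (v : V)

/-- A linear equivalence of the whole spaces which preserves the forms. -/
def IsIsometry (B : LinearMap.BilinForm F V) (B' : LinearMap.BilinForm F V')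
    (ψ : V ≃ₗ[F] V') : Prop :=
  ∀ u v : V, B' (ψ u) (ψ v) = B u v

/-- The two metric spaces `(V,B)` and `(V',B')` are isometric. -/
def AreIsometric (B : LinearMap.BilinForm F V) (B' : LinearMap.BilinForm F V') : Prop :=
  ∃ ψ : V ≃ₗ[F] V', IsIsometry B B' ψ

/-- The subspaces `N ⊆ V` and `N' ⊆ V'` are isometric with respect to the
restrictions of the ambient forms. -/
def SubIsometric (B : LinearMap.BilinForm F V) (B' : LinearMap.BilinForm F V')
    (N : Submodule F V) (N' : Submodule F V') : Prop :=
  ∃ ψ : N ≃ₗ[F] N', IsIsometryOn B B' N N' ψ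

/-- A subspace is totally isotropic. -/
def TotIsotropic (B : LinearMap.BilinForm F V) (N : Submodule F V) : Prop :=
  ∀ u ∈ N, ∀ v ∈ N, B u v = 0

end Witt

open Module Witt

section LinearAlgebra

variable {F V V' Q : Type*} [Field F] [AddCommGroup V] [Module F V] [AddCommGroup V'] [Module F V']
  [AddCommGroup Q] [Module F Q]

/-- Two linear maps that agree on `S ⊓ T` can be glued along `S` and `T`. -/
theorem exists_linearMap_glue (f g : V →ₗ[F] V') (S T : Submodule F V)
    (h : ∀ x ∈ S, x ∈ T → f x = g x) :
    ∃ k : V →ₗ[F] V', (∀ x ∈ S, k x = f x) ∧ ∀ x ∈ T, k x = g x := by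
  have H : ∀ (x : (⟨S, f.domRestrict S⟩ : V →ₗ.[F] V').domain)
      (y : (⟨T, g.domRestrict T⟩ : V →ₗ.[F] V').domain), (x : V) = y →
      (⟨S, f.domRestrict S⟩ : V →ₗ.[F] V') x = (⟨T, g.domRestrict T⟩ : V →ₗ.[F] V') y := by
    rintro ⟨x, hx⟩ ⟨y, hy⟩ (rfl : x = y)
    exact h x hx hy
  obtain ⟨k, hk⟩ := (LinearPMap.sup _ _ H).toFun.exists_extend
  refine ⟨k, fun x hx => ?_, fun x hx => ?_⟩
  · have h1 : k x = _ := LinearMap.congr_fun hk ⟨x, Submodule.mem_sup_left hx⟩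
    rw [h1]
    exact ((LinearPMap.left_le_sup _ _ H).2 (x := ⟨x, hx⟩) rfl).symm
  · have h1 : k x = _ := LinearMap.congr_fun hk ⟨x, Submodule.mem_sup_right hx⟩
    rw [h1]
    exact ((LinearPMap.right_le_sup _ _ H).2 (x := ⟨x, hx⟩) rfl).symm

theorem exists_disjoint_sup_eq (S T : Submodule F V) (h : S ≤ T) :
    ∃ C : Submodule F V, C ≤ T ∧ Disjoint S C ∧ S ⊔ C = T := by
  obtain ⟨C, hC⟩ := S.exists_isCompl
  refine ⟨C ⊓ T, inf_le_right, hC.disjoint.mono_right inf_le_left, ?_⟩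
  rw [← sup_inf_assoc_of_le C h, hC.sup_eq_top, top_inf_eq]

/-- A lift, prescribed on `S`, of the linear map `c` on `M` through `T` restricted to `R`. -/
theorem exists_lift_extend (R S : Submodule F V) (M : Submodule F V) (hSM : S ≤ M)
    (T c : V →ₗ[F] Q) (k : V →ₗ[F] V) (hk : ∀ x ∈ S, k x ∈ R) (hkc : ∀ x ∈ S, T (k x) = c x)
    (hc : ∀ x ∈ M, ∃ r ∈ R, T r = c x) :
    ∃ h : V →ₗ[F] V, (∀ x ∈ M, h x ∈ R ∧ T (h x) = c x) ∧ ∀ x ∈ S, h x = k x := by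
  obtain ⟨C, hCM, hSC, hsup⟩ := exists_disjoint_sup_eq S M hSM
  obtain ⟨s, hs⟩ := (T.domRestrict R).rangeRestrict.exists_rightInverse_of_surjective
    (LinearMap.range_rangeRestrict _)
  have hmem : ∀ x : C, c.domRestrict C x ∈ LinearMap.range (T.domRestrict R) := by
    intro x
    obtain ⟨r, hr, hrx⟩ := hc x (hCM x.2)
    exact ⟨⟨r, hr⟩, hrx⟩
  obtain ⟨l, hl⟩ := (R.subtype ∘ₗ s ∘ₗ (c.domRestrict C).codRestrict _ hmem).exists_extend
  have hlC : ∀ x ∈ C, l x ∈ R ∧ T (l x) = c x := by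
    intro x hx
    have h1 : l x = _ := LinearMap.congr_fun hl ⟨x, hx⟩
    rw [h1]
    refine ⟨Subtype.coe_prop _, ?_⟩
    exact congrArg Subtype.val (LinearMap.congr_fun hs ⟨c x, hmem ⟨x, hx⟩⟩)
  obtain ⟨h, hS, hC⟩ := exists_linearMap_glue k l S C (by
    intro x hx hx'
    rw [(Submodule.disjoint_def.1 hSC) x hx hx', map_zero, map_zero])
  refine ⟨h, fun x hx => ?_, hS⟩
  rw [← hsup] at hx
  obtain ⟨a, ha, b, hb, rfl⟩ := Submodule.mem_sup.1 hx
  rw [map_add, hS a ha, hC b hb, map_add, map_add, hkc a ha, (hlC b hb).2]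
  exact ⟨R.add_mem (hk a ha) (hlC b hb).1, rfl⟩

theorem finrank_map_eq_of_forall_mem (S : Submodule F V) (f : V →ₗ[F] V')
    (hf : ∀ x ∈ S, f x = 0 → x = 0) : finrank F (S.map f) = finrank F S := by
  refine (LinearEquiv.finrank_eq (LinearEquiv.ofBijective (f.submoduleMap S) ⟨?_, ?_⟩)).symm
  · refine (injective_iff_map_eq_zero _).2 fun x hx => ?_
    exact Subtype.ext (hf x x.2 (congrArg Subtype.val hx))
  · exact f.submoduleMap_surjective S

theorem exists_injOn_extend [FiniteDimensional F V] (S K K' : Submodule F V) (hSK : S ≤ K)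
    (hfin : finrank F K = finrank F K') (f : V →ₗ[F] V) (hf : ∀ x ∈ S, f x = 0 → x = 0)
    (hfK : ∀ x ∈ S, f x ∈ K') :
    ∃ k : V →ₗ[F] V, (∀ x ∈ S, k x = f x) ∧ (∀ x ∈ K, k x ∈ K') ∧ ∀ x ∈ K, k x = 0 → x = 0 := by
  obtain ⟨C, hCK, hSC, hsup⟩ := exists_disjoint_sup_eq S K hSK
  have hSK' : S.map f ≤ K' := by
    rintro _ ⟨x, hx, rfl⟩
    exact hfK x hx
  obtain ⟨C', hCK', hSC', hsup'⟩ := exists_disjoint_sup_eq (S.map f) K' hSK'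
  have hSfin := finrank_map_eq_of_forall_mem S f hf
  have h1 := Submodule.finrank_sup_add_finrank_inf_eq S C
  have h2 := Submodule.finrank_sup_add_finrank_inf_eq (S.map f) C'
  rw [hsup, hSC.eq_bot, finrank_bot] at h1
  rw [hsup', hSC'.eq_bot, finrank_bot] at h2
  let e : C ≃ₗ[F] C' := LinearEquiv.ofFinrankEq _ _ (by omega)
  obtain ⟨l, hl⟩ := (C'.subtype ∘ₗ e.toLinearMap).exists_extend
  have hlC : ∀ x (hx : x ∈ C), l x = e ⟨x, hx⟩ := fun x hx => LinearMap.congr_fun hl ⟨x, hx⟩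
  obtain ⟨k, hS, hC⟩ := exists_linearMap_glue f l S C (by
    intro x hx hx'
    rw [(Submodule.disjoint_def.1 hSC) x hx hx', map_zero, map_zero])
  refine ⟨k, hS, fun x hx => ?_, fun x hx hx0 => ?_⟩
  · rw [← hsup] at hx
    obtain ⟨a, ha, b, hb, rfl⟩ := Submodule.mem_sup.1 hx
    rw [map_add, hS a ha, hC b hb, hlC b hb]
    exact K'.add_mem (hfK a ha) (hCK' (Subtype.coe_prop _))
  · rw [← hsup] at hx
    obtain ⟨a, ha, b, hb, rfl⟩ := Submodule.mem_sup.1 hx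
    rw [map_add, hS a ha, hC b hb, hlC b hb] at hx0
    have h3 : f a ∈ C' := by
      rw [eq_neg_of_add_eq_zero_left hx0]
      exact C'.neg_mem (Subtype.coe_prop _)
    have h4 : f a = 0 := (Submodule.disjoint_def.1 hSC') _ ⟨a, ha, rfl⟩ h3
    rw [h4, zero_add] at hx0
    have h5 : e ⟨b, hb⟩ = 0 := Subtype.ext hx0
    rw [LinearEquiv.map_eq_zero_iff] at h5
    rw [hf a ha h4, zero_add]
    exact congrArg Subtype.val h5

theorem map_eq_of_injective_of_forall_mem [FiniteDimensional F V] (g : V →ₗ[F] V)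
    (hg : Function.Injective g) (R : Submodule F V) (h : ∀ x ∈ R, g x ∈ R) : R.map g = R := by
  refine Submodule.eq_of_le_of_finrank_eq ?_ (R.equivMapOfInjective g hg).finrank_eq.symm
  rintro _ ⟨x, hx, rfl⟩
  exact h x hx

end LinearAlgebra

section WittExtension

variable {F V : Type*} [Field F] [AddCommGroup V] [Module F V] {B : LinearMap.BilinForm F V}

theorem isRefl_of_symm (hB : ∀ u v, B u v = B v u) : B.IsRefl :=
  fun x y h => (hB y x).trans h

theorem injective_of_isometry {V' : Type*} [AddCommGroup V'] [Module F V']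
    {B' : LinearMap.BilinForm F V'} (hnd : B.Nondegenerate)
    {g : V →ₗ[F] V'} (hg : ∀ u v, B' (g u) (g v) = B u v) : Function.Injective g := by
  refine (injective_iff_map_eq_zero g).2 fun x hx => hnd.1 x fun v => ?_
  rw [← hg, hx, map_zero, LinearMap.zero_apply]

theorem exists_mem_orthogonal_apply_eq_one [FiniteDimensional F V] (hB : ∀ u v, B u v = B v u)
    (hnd : B.Nondegenerate) (U : Submodule F V) {x : V} (hx : x ∉ U) :
    ∃ z, (∀ u ∈ U, B u z = 0) ∧ B x z = 1 := by
  have : x ∉ B.orthogonal (B.orthogonal U) := by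
    rwa [LinearMap.BilinForm.orthogonal_orthogonal hnd (isRefl_of_symm hB)]
  rw [LinearMap.BilinForm.mem_orthogonal_iff] at this
  push Not at this
  obtain ⟨z, hz, hzx⟩ := this
  rw [LinearMap.BilinForm.mem_orthogonal_iff] at hz
  refine ⟨(B z x)⁻¹ • z, fun u hu => ?_, ?_⟩
  · rw [map_smul, hz u hu, smul_zero]
  · rw [map_smul, hB x z, smul_eq_mul, inv_mul_cancel₀ hzx]

theorem exists_isometry_fixing_of_apply_eq [FiniteDimensional F V] (hchar : (2 : F) ≠ 0)
    (hB : ∀ u v, B u v = B v u) (hnd : B.Nondegenerate) (U : Submodule F V) {x y : V}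
    (hx : x ∉ U) (hy : y ∉ U) (hxy : B x x = B y y) (hU : ∀ u ∈ U, B u x = B u y) :
    ∃ τ : V →ₗ[F] V, (∀ u v, B (τ u) (τ v) = B u v) ∧ (∀ u ∈ U, τ u = u) ∧ τ x = y := by
  obtain ⟨w, rfl⟩ : ∃ w, y = x - w := ⟨x - y, by abel⟩
  have hUw : ∀ u ∈ U, B w u = 0 := by
    intro u hu
    have := hU u hu
    rw [map_sub] at this
    rw [hB w u]
    linear_combination this
  have hxw : 2 * B w x = B w w := by
    simp only [map_sub, LinearMap.sub_apply, hB x w] at hxy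
    linear_combination hxy
  by_cases hww : B w w = 0
  · have hwx : B w x = 0 := by
      rw [hww] at hxw
      exact (mul_eq_zero.1 hxw).resolve_left hchar
    by_cases hxUw : x ∈ U ⊔ F ∙ w
    · obtain ⟨u₀, hu₀, w', hw', hx'⟩ := Submodule.mem_sup.1 hxUw
      obtain ⟨a, rfl⟩ := Submodule.mem_span_singleton.1 hw'
      have ha : a ≠ 0 := by
        rintro rfl
        rw [zero_smul, add_zero] at hx'
        exact hx (hx' ▸ hu₀)
      have ha1 : a - 1 ≠ 0 := by
        intro h
        apply hy
        rw [← hx', sub_eq_zero.1 h, one_smul, add_sub_cancel_right]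
        exact hu₀
      have hwU : w ∉ U := by
        intro h
        exact hx (hx' ▸ U.add_mem hu₀ (U.smul_mem a h))
      obtain ⟨z₀, hz₀U, hz₀⟩ := exists_mem_orthogonal_apply_eq_one hB hnd U hwU
      obtain ⟨z, hzU, hwz, hzz⟩ : ∃ z, (∀ u ∈ U, B z u = 0) ∧ B w z = 1 ∧ B z z = 0 := by
        refine ⟨z₀ - (B z₀ z₀ / 2) • w, fun u hu => ?_, ?_, ?_⟩
        · simp [hB z₀ u, hz₀U u hu, hUw u hu]
        · simp [hz₀, hww]
        · simp only [map_sub, map_smul, LinearMap.sub_apply, LinearMap.smul_apply, smul_eq_mul,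
            hB z₀ w, hz₀, hww]
          field_simp
          ring
      let c := (a - 1) / a
      have hc : c * c⁻¹ = 1 := mul_inv_cancel₀ (div_ne_zero ha1 ha)
      let τ : V →ₗ[F] V := LinearMap.id + (c - 1) • (B z).smulRight w
        + (c⁻¹ - 1) • (B w).smulRight z
      have hτ : ∀ v, τ v = v + ((c - 1) * B z v) • w + ((c⁻¹ - 1) * B w v) • z := by
        intro v
        simp [τ, mul_smul]
      refine ⟨τ, fun u v => ?_, fun u hu => ?_, ?_⟩
      · simp only [hτ, map_add, map_smul, LinearMap.add_apply, LinearMap.smul_apply, smul_eq_mul,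
          hB u w, hB u z, hB z w, hwz, hzz, hww]
        linear_combination (B z u * B w v + B w u * B z v) * hc
      · rw [hτ, hzU u hu, hUw u hu]
        simp
      · rw [hτ, ← hx']
        simp only [map_add, map_smul, hzU u₀ hu₀, hUw u₀ hu₀, hB z w, hwz, hww, smul_eq_mul]
        have : (c - 1) * a = -1 := by
          simp only [c]
          field_simp
          ring
        rw [mul_zero, add_zero, mul_zero, zero_smul, add_zero, zero_add, mul_one, this, neg_one_smul,
          sub_eq_add_neg]
    · obtain ⟨z, hz, hxz⟩ := exists_mem_orthogonal_apply_eq_one hB hnd _ hxUw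
      have hzU : ∀ u ∈ U, B z u = 0 := fun u hu => by
        rw [hB]; exact hz u (Submodule.mem_sup_left hu)
      have hwz : B w z = 0 := hz w (Submodule.mem_sup_right (Submodule.mem_span_singleton_self w))
      let τ : V →ₗ[F] V := LinearMap.id + (B w).smulRight z - (B z).smulRight w
        - (B z z / 2) • (B w).smulRight w
      have hτ : ∀ v, τ v = v + B w v • z - B z v • w - (B z z / 2 * B w v) • w := by
        intro v
        simp [τ, mul_smul]
      refine ⟨τ, fun u v => ?_, fun u hu => ?_, ?_⟩
      · simp only [hτ, map_add, map_sub, map_smul, LinearMap.add_apply, LinearMap.sub_apply,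
          LinearMap.smul_apply, smul_eq_mul, hB u w, hB u z, hB z w, hwz, hww]
        field_simp
        ring
      · rw [hτ, hzU u hu, hUw u hu]
        simp
      · rw [hτ, hwx, hB z x, hxz]
        simp
  · let τ : V →ₗ[F] V := LinearMap.id - (2 / B w w) • (B w).smulRight w
    have hτ : ∀ v, τ v = v - (2 / B w w * B w v) • w := by
      intro v
      simp [τ, mul_smul]
    refine ⟨τ, fun u v => ?_, fun u hu => ?_, ?_⟩
    · simp only [hτ, map_sub, map_smul, LinearMap.sub_apply,
          LinearMap.smul_apply, smul_eq_mul, hB u w]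
      field_simp
      ring
    · rw [hτ, hUw u hu]
      simp
    · rw [hτ, div_mul_eq_mul_div, hxw, div_self hww, one_smul]

/-- **Witt's extension theorem** for a single nonsingular space. -/
theorem exists_isometry_extend_endo [FiniteDimensional F V] (hchar : (2 : F) ≠ 0)
    (hB : ∀ u v, B u v = B v u) (hnd : B.Nondegenerate) (U : Submodule F V) (f : V →ₗ[F] V)
    (hinj : ∀ x ∈ U, f x = 0 → x = 0) (hf : ∀ x ∈ U, ∀ y ∈ U, B (f x) (f y) = B x y) :
    ∃ g : V →ₗ[F] V, (∀ u v, B (g u) (g v) = B u v) ∧ ∀ x ∈ U, g x = f x := by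
  induction U, IsNoetherian.noetherian U using Submodule.fg_sup_span_induction with
  | bot =>
    refine ⟨LinearMap.id, fun _ _ => rfl, fun x hx => ?_⟩
    rw [(Submodule.mem_bot F).1 hx, map_zero, map_zero]
  | sup N x _ ih =>
    have hxm : x ∈ N ⊔ F ∙ x := Submodule.mem_sup_right (Submodule.mem_span_singleton_self x)
    have hNm : ∀ u ∈ N, u ∈ N ⊔ F ∙ x := fun u hu => Submodule.mem_sup_left hu
    obtain ⟨g, hg, hgN⟩ := ih (fun u hu => hinj u (hNm u hu))
      (fun u hu v hv => hf u (hNm u hu) v (hNm v hv))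
    by_cases hx : x ∈ N
    · rw [sup_eq_left.2 ((Submodule.span_singleton_le_iff_mem x N).2 hx)]
      exact ⟨g, hg, hgN⟩
    · obtain ⟨y, hy⟩ := LinearMap.injective_iff_surjective.1 (injective_of_isometry hnd hg) (f x)
      have hyN : y ∉ N := by
        intro h
        have h1 : x - y = 0 := hinj _ (Submodule.sub_mem _ hxm (hNm y h)) (by
          rw [map_sub, ← hgN y h, hy, sub_self])
        exact hx (sub_eq_zero.1 h1 ▸ h)
      obtain ⟨τ, hτ, hτN, hτx⟩ := exists_isometry_fixing_of_apply_eq hchar hB hnd N hx hyN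
        (by rw [← hf x hxm x hxm, ← hy, hg])
        (fun u hu => by rw [← hf u (hNm u hu) x hxm, ← hy, ← hgN u hu, hg])
      refine ⟨g ∘ₗ τ, fun u v => (hg _ _).trans (hτ u v), fun v hv => ?_⟩
      obtain ⟨u, hu, w, hw, rfl⟩ := Submodule.mem_sup.1 hv
      obtain ⟨a, rfl⟩ := Submodule.mem_span_singleton.1 hw
      simp only [LinearMap.comp_apply, map_add, map_smul, hτN u hu, hτx, hgN u hu, hy]

/-- **Witt's extension theorem** for a pair of isometric nonsingular spaces. -/
theorem exists_isometry_extend [FiniteDimensional F V] {V' : Type*} [AddCommGroup V'] [Module F V']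
    {B' : LinearMap.BilinForm F V'} (hchar : (2 : F) ≠ 0)
    (hB : ∀ u v, B u v = B v u) (hnd : B.Nondegenerate) (ψ : V ≃ₗ[F] V')
    (hψ : ∀ u v, B' (ψ u) (ψ v) = B u v) (U : Submodule F V) (f : V →ₗ[F] V')
    (hinj : ∀ x ∈ U, f x = 0 → x = 0) (hf : ∀ x ∈ U, ∀ y ∈ U, B' (f x) (f y) = B x y) :
    ∃ g : V ≃ₗ[F] V', (∀ u v, B' (g u) (g v) = B u v) ∧ ∀ x ∈ U, g x = f x := by
  obtain ⟨g, hg, hgU⟩ := exists_isometry_extend_endo hchar hB hnd U (ψ.symm.toLinearMap ∘ₗ f)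
    (fun x hx h => hinj x hx (ψ.symm.map_eq_zero_iff.1 h))
    (fun x hx y hy => by
      rw [← hψ, LinearMap.comp_apply, LinearMap.comp_apply, LinearEquiv.coe_coe,
        ψ.apply_symm_apply, ψ.apply_symm_apply, hf x hx y hy])
  refine ⟨(LinearEquiv.ofInjectiveEndo g (injective_of_isometry hnd hg)).trans ψ,
    fun u v => (hψ _ _).trans (hg u v), fun x hx => ?_⟩
  have : ψ (g x) = f x := by
    rw [hgU x hx]
    exact ψ.apply_symm_apply _
  exact this

/-- Given a partial isometry `f` respecting a subspace `A` and its orthogonal complement `P`, the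
map it induces modulo `P` on `A` is realised by an isometry that fixes `P` pointwise. -/
theorem exists_isometry_fixing_orthogonal [FiniteDimensional F V] (hchar : (2 : F) ≠ 0)
    (hB : ∀ u v, B u v = B v u) (hnd : B.Nondegenerate) {A P : Submodule F V}
    (hA : A = B.orthogonal P) (E : Submodule F V) (f : V →ₗ[F] V)
    (hM : ∀ e ∈ E, e ∈ A ⊔ P → f e ∈ A ⊔ P) (hP : ∀ e ∈ E, e ∈ P ↔ f e ∈ P)
    (hφ : ∀ a₁ ∈ A, ∀ p₁ ∈ P, ∀ a₂ ∈ A, ∀ p₂ ∈ P, ∀ a₁' ∈ A, ∀ p₁' ∈ P, ∀ a₂' ∈ A, ∀ p₂' ∈ P,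
      a₁ + p₁ ∈ E → a₂ + p₂ ∈ E → f (a₁ + p₁) = a₁' + p₁' → f (a₂ + p₂) = a₂' + p₂' →
      B a₁' a₂' = B a₁ a₂) :
    ∃ G : V →ₗ[F] V, (∀ u v, B (G u) (G v) = B u v) ∧ (∀ p ∈ P, G p = p) ∧ (∀ a ∈ A, G a ∈ A) ∧
      ∀ a ∈ A, ∀ p ∈ P, ∀ a' ∈ A, ∀ p' ∈ P, a + p ∈ E → f (a + p) = a' + p' → G a - a' ∈ P := by
  have hPA : ∀ p ∈ P, ∀ a ∈ A, B p a = 0 := fun p hp a ha => by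
    rw [hA] at ha
    exact ha p hp
  obtain ⟨A₀, hA₀, hdisj, hsup⟩ := exists_disjoint_sup_eq (A ⊓ P) A inf_le_left
  obtain ⟨α, hαA₀, hαP⟩ := exists_linearMap_glue LinearMap.id (0 : V →ₗ[F] V) A₀ P
    (fun x hx hxP => (Submodule.disjoint_def.1 hdisj) x ⟨hA₀ hx, hxP⟩ hx)
  have hα : ∀ a ∈ A, α a ∈ A ∧ a - α a ∈ P := by
    intro a ha
    rw [← hsup] at ha
    obtain ⟨r, hr, b, hb, rfl⟩ := Submodule.mem_sup.1 ha
    have : α (r + b) = b := by rw [map_add, hαA₀ b hb, hαP r hr.2]; simp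
    rw [this, add_sub_cancel_right]
    exact ⟨hA₀ hb, hr.2⟩
  have hαM : ∀ x ∈ A ⊔ P, α x ∈ A ∧ x - α x ∈ P := by
    intro x hx
    obtain ⟨a, ha, p, hp, rfl⟩ := Submodule.mem_sup.1 hx
    have : α (a + p) = α a := by rw [map_add, hαP p hp]; simp
    rw [this, add_sub_right_comm]
    exact ⟨(hα a ha).1, P.add_mem (hα a ha).2 hp⟩
  obtain ⟨C, hC, hCdisj, hCsup⟩ := exists_disjoint_sup_eq (E ⊓ P) (E ⊓ (A ⊔ P))
    (inf_le_inf_left _ le_sup_right)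
  have hCP : ∀ c ∈ C, α c ∈ P → c = 0 := by
    intro c hc h
    refine (Submodule.disjoint_def.1 hCdisj) c ⟨(hC hc).1, ?_⟩ hc
    have := P.add_mem (hαM c (hC hc).2).2 h
    rwa [sub_add_cancel] at this
  obtain ⟨β, hβ⟩ := (α.domRestrict C).exists_leftInverse_of_injective (by
    refine LinearMap.ker_eq_bot'.2 fun c hc => Subtype.ext (hCP c c.2 ?_)
    have : α c = 0 := hc
    rw [this]
    exact P.zero_mem)
  have hβα : ∀ c ∈ C, (β (α c) : V) = c := fun c hc =>
    congrArg Subtype.val (LinearMap.congr_fun hβ ⟨c, hc⟩)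
  obtain ⟨k, hkP, hkC⟩ := exists_linearMap_glue LinearMap.id (α ∘ₗ f ∘ₗ C.subtype ∘ₗ β) P (C.map α)
    (by
      rintro _ hxP ⟨c, hc, rfl⟩
      rw [hCP c hc hxP]
      simp)
  have hkC' : ∀ c ∈ C, k (α c) = α (f c) := fun c hc => by
    rw [hkC _ ⟨c, hc, rfl⟩]
    exact congrArg (fun v => α (f v)) (hβα c hc)
  have hfC : ∀ c ∈ C, f c ∈ A ⊔ P := fun c hc => hM c (hC hc).1 (hC hc).2
  obtain ⟨G, hG, hGU⟩ := exists_isometry_extend_endo hchar hB hnd (P ⊔ C.map α) k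
    (by
      intro x hx h
      obtain ⟨p, hp, _, ⟨c, hc, rfl⟩, rfl⟩ := Submodule.mem_sup.1 hx
      rw [map_add, hkP p hp, hkC' c hc, LinearMap.id_apply] at h
      have h1 : α (f c) ∈ P := by
        rw [eq_neg_of_add_eq_zero_right h]
        exact P.neg_mem hp
      have h2 : f c ∈ P := by
        have := P.add_mem (hαM _ (hfC c hc)).2 h1
        rwa [sub_add_cancel] at this
      have h3 : c = 0 := (Submodule.disjoint_def.1 hCdisj) c
        ⟨(hC hc).1, (hP c (hC hc).1).2 h2⟩ hc
      rw [h3] at h ⊢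
      simpa using h)
    (by
      intro x hx y hy
      obtain ⟨p, hp, _, ⟨c, hc, rfl⟩, rfl⟩ := Submodule.mem_sup.1 hx
      obtain ⟨q, hq, _, ⟨d, hd, rfl⟩, rfl⟩ := Submodule.mem_sup.1 hy
      have h1 := hαM c (hC hc).2
      have h2 := hαM d (hC hd).2
      have h3 := hαM _ (hfC c hc)
      have h4 := hαM _ (hfC d hd)
      have h5 := hφ _ h1.1 _ h1.2 _ h2.1 _ h2.2 _ h3.1 _ h3.2 _ h4.1 _ h4.2
      simp only [add_sub_cancel] at h5
      have h6 := h5 (hC hc).1 (hC hd).1 trivial trivial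
      simp only [map_add, hkP p hp, hkP q hq, hkC' c hc, hkC' d hd, LinearMap.id_apply,
        LinearMap.add_apply, h6, hPA p hp _ h2.1, hPA p hp _ h4.1, hB _ q, hPA q hq _ h1.1,
        hPA q hq _ h3.1])
  have hGP : ∀ p ∈ P, G p = p := fun p hp => by
    rw [hGU p (Submodule.mem_sup_left hp), hkP p hp, LinearMap.id_apply]
  refine ⟨G, hG, hGP, fun a ha => ?_, fun a ha p hp a' ha' p' hp' hE hf => ?_⟩
  · rw [hA, LinearMap.BilinForm.mem_orthogonal_iff]
    intro p hp
    have := hG p a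
    rwa [hGP p hp, hPA p hp a ha] at this
  · have hmem : a + p ∈ E ⊓ (A ⊔ P) := ⟨hE, Submodule.add_mem_sup ha hp⟩
    rw [← hCsup] at hmem
    obtain ⟨q, hq, c, hc, hqc⟩ := Submodule.mem_sup.1 hmem
    have h1 : α a = α c := by
      have := congrArg α hqc
      rw [map_add, map_add, hαP q hq.2, hαP p hp] at this
      simpa using this.symm
    have h2 : α a' = α (f c) := by
      have := congrArg α hf
      rw [← hqc, map_add, map_add, map_add, hαP _ ((hP q hq.1).1 hq.2), hαP p' hp'] at this
      simpa using this.symm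
    have h3 : G a = α a' + (a - α a) := by
      rw [← hGP _ (hα a ha).2, map_sub, h1, hGU _ (Submodule.mem_sup_right ⟨c, hc, rfl⟩),
        hkC' c hc, h2]
      abel
    have h4 : G a - a' = (a - α a) - (a' - α a') := by rw [h3]; abel
    rw [h4]
    exact P.sub_mem (hα a ha).2 (hα a' ha').2

theorem exists_mem_apply_eq_of_sub_mem [FiniteDimensional F V] (hB : ∀ u v, B u v = B v u)
    {R M : Submodule F V} (hMR : M = B.orthogonal R) (E : Submodule F V) (f : V →ₗ[F] V)
    (hM : ∀ e ∈ E, f e ∈ M → e ∈ M) (hfR : ∀ e ∈ E, e ∈ M → f e - e ∈ R) {x : V} (hx : x ∈ M) :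
    ∃ r ∈ R, ∀ e ∈ E, B (f e) r = B (e - f e) x := by
  let T : V →ₗ[F] Dual F E := (B.compl₁₂ (f ∘ₗ E.subtype) LinearMap.id).flip
  let c : V →ₗ[F] Dual F E := (B.compl₁₂ (E.subtype - f ∘ₗ E.subtype) LinearMap.id).flip
  have h : c x ∈ R.map T := by
    have hT : (R.map T).dualCoannihilator.dualAnnihilator = R.map T :=
      Subspace.dualCoannihilator_dualAnnihilator_eq
    rw [← hT, Submodule.mem_dualAnnihilator]
    intro e he
    rw [Submodule.mem_dualCoannihilator] at he
    have h1 : f e ∈ M := by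
      rw [hMR, LinearMap.BilinForm.mem_orthogonal_iff]
      intro r hr
      rw [hB]
      exact he (T r) ⟨r, hr, rfl⟩
    have h2 := hfR e e.2 (hM e e.2 h1)
    rw [hMR] at hx
    have h3 : B (f e - e) x = 0 := hx _ h2
    have h4 : B (e - f e) x = 0 := by rw [← neg_sub, map_neg, LinearMap.neg_apply, h3, neg_zero]
    exact h4
  obtain ⟨r, hr, hrc⟩ := h
  exact ⟨r, hr, fun e he => LinearMap.congr_fun hrc ⟨e, he⟩⟩

theorem finrank_inf_orthogonal_eq_of_iff [FiniteDimensional F V]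
    (hnd : B.Nondegenerate) {R M : Submodule F V} (hRM : R = B.orthogonal M)
    (E : Submodule F V) (f : V →ₗ[F] V) (hinj : ∀ x ∈ E, f x = 0 → x = 0)
    (hM : ∀ e ∈ E, e ∈ M ↔ f e ∈ M) :
    finrank F ↥(R ⊓ B.orthogonal E) = finrank F ↥(R ⊓ B.orthogonal (E.map f)) := by
  have horth : ∀ S : Submodule F V, R ⊓ B.orthogonal S = B.orthogonal (M ⊔ S) := by
    intro S
    ext x
    simp only [hRM, Submodule.mem_inf, LinearMap.BilinForm.mem_orthogonal_iff]
    refine ⟨fun h y hy => ?_, fun h => ⟨fun y hy => h y (Submodule.mem_sup_left hy),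
      fun y hy => h y (Submodule.mem_sup_right hy)⟩⟩
    obtain ⟨m, hm, s, hs, rfl⟩ := Submodule.mem_sup.1 hy
    rw [map_add, LinearMap.add_apply, h.1 m hm, h.2 s hs, add_zero]
  have hmap : ∀ S ≤ E, finrank F (S.map f) = finrank F S := fun S hS =>
    finrank_map_eq_of_forall_mem S f fun x hx => hinj x (hS hx)
  have hinf : M ⊓ E.map f = (M ⊓ E).map f := by
    ext x
    constructor
    · rintro ⟨hx, e, he, rfl⟩
      exact ⟨e, ⟨(hM e he).2 hx, he⟩, rfl⟩
    · rintro ⟨e, ⟨hm, he⟩, rfl⟩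
      exact ⟨(hM e he).1 hm, e, he, rfl⟩
  have h1 := Submodule.finrank_sup_add_finrank_inf_eq M E
  have h2 := Submodule.finrank_sup_add_finrank_inf_eq M (E.map f)
  rw [hinf, hmap _ inf_le_right, hmap E le_rfl] at h2
  rw [horth, horth, LinearMap.BilinForm.finrank_orthogonal hnd,
    LinearMap.BilinForm.finrank_orthogonal hnd]
  omega

/-- A partial isometry that is the identity modulo the totally isotropic subspace `R` on
`M = Rᗮ` extends to an isometry with the same property. -/
theorem exists_isometry_extend_of_sub_mem [FiniteDimensional F V] (hchar : (2 : F) ≠ 0)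
    (hB : ∀ u v, B u v = B v u) (hnd : B.Nondegenerate) {R M : Submodule F V}
    (hRM : R = B.orthogonal M) (hMR : M = B.orthogonal R) (hle : R ≤ M)
    (E : Submodule F V) (f : V →ₗ[F] V) (hinj : ∀ x ∈ E, f x = 0 → x = 0)
    (hf : ∀ x ∈ E, ∀ y ∈ E, B (f x) (f y) = B x y)
    (hM : ∀ e ∈ E, e ∈ M ↔ f e ∈ M) (hfR : ∀ e ∈ E, e ∈ M → f e - e ∈ R) :
    ∃ g : V →ₗ[F] V, (∀ u v, B (g u) (g v) = B u v) ∧ (∀ e ∈ E, g e = f e) ∧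
      ∀ x ∈ M, g x - x ∈ R := by
  have hMR0 : ∀ x ∈ M, ∀ r ∈ R, B x r = 0 := fun x hx r hr => by
    rw [hRM] at hr
    exact hr x hx
  obtain ⟨k, hkE, hkK, hkinj⟩ := exists_injOn_extend (E ⊓ (R ⊓ B.orthogonal E))
    (R ⊓ B.orthogonal E) (R ⊓ B.orthogonal (E.map f)) inf_le_right
    (finrank_inf_orthogonal_eq_of_iff hnd hRM E f hinj hM) f (fun x hx => hinj x hx.1) (by
      rintro x ⟨hxE, hxR, hx⟩
      constructor
      · have := R.add_mem (hfR x hxE (hle hxR)) hxR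
        rwa [sub_add_cancel] at this
      · rintro _ ⟨e, he, rfl⟩
        exact (hf e he x hxE).trans (hx e he))
  obtain ⟨k₂, hk₂E, hk₂K⟩ := exists_linearMap_glue (f - LinearMap.id) (k - LinearMap.id)
    (E ⊓ M) (R ⊓ B.orthogonal E) (fun x hx hxK => by
      rw [LinearMap.sub_apply, LinearMap.sub_apply, hkE x ⟨hx.1, hxK⟩])
  simp only [LinearMap.sub_apply, LinearMap.id_apply] at hk₂E hk₂K
  let T : V →ₗ[F] Dual F E := (B.compl₁₂ (f ∘ₗ E.subtype) LinearMap.id).flip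
  let c : V →ₗ[F] Dual F E := (B.compl₁₂ (E.subtype - f ∘ₗ E.subtype) LinearMap.id).flip
  have hTc : ∀ x y, T x = c y ↔ ∀ e ∈ E, B (f e) x = B (e - f e) y := fun x y =>
    ⟨fun h e he => LinearMap.congr_fun h ⟨e, he⟩, fun h => LinearMap.ext fun e => h e e.2⟩
  obtain ⟨h, hhM, hhS⟩ := exists_lift_extend R (E ⊓ M ⊔ (R ⊓ B.orthogonal E)) M
    (sup_le inf_le_right (inf_le_left.trans hle)) T c k₂
    (fun x hx => by
      obtain ⟨e, he, r, hr, rfl⟩ := Submodule.mem_sup.1 hx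
      rw [map_add, hk₂E e he, hk₂K r hr]
      exact R.add_mem (hfR e he.1 he.2) (R.sub_mem (hkK r hr).1 hr.1))
    (fun x hx => by
      obtain ⟨e, he, r, hr, rfl⟩ := Submodule.mem_sup.1 hx
      rw [hTc, map_add, hk₂E e he, hk₂K r hr]
      intro y hy
      have h1 : B (f y) (k r) = 0 := (hkK r hr).2 (f y) ⟨y, hy, rfl⟩
      have h2 : B y r = 0 := hr.2 y hy
      simp only [map_add, map_sub, LinearMap.sub_apply, h1, h2, hf y hy e he.1])
    (fun x hx => by
      obtain ⟨r, hr, hrx⟩ := exists_mem_apply_eq_of_sub_mem hB hMR E f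
        (fun e he => (hM e he).2) hfR hx
      exact ⟨r, hr, (hTc r x).2 hrx⟩)
  have hhT : ∀ x ∈ M, ∀ e ∈ E, B (f e) (x + h x) = B e x := by
    intro x hx e he
    rw [map_add, (hTc _ _).1 (hhM x hx).2 e he, map_sub, LinearMap.sub_apply]
    ring
  have hhinj : ∀ x ∈ M, x + h x = 0 → x = 0 := by
    intro x hx hx0
    have hxR : x ∈ R := by
      rw [eq_neg_of_add_eq_zero_left hx0]
      exact R.neg_mem (hhM x hx).1
    have hxK : x ∈ R ⊓ B.orthogonal E := by
      refine ⟨hxR, fun e he => ?_⟩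
      rw [← hhT x hx e he, hx0, map_zero]
    refine hkinj x hxK ?_
    rw [hhS x (Submodule.mem_sup_right hxK), hk₂K x hxK] at hx0
    simpa using hx0
  obtain ⟨l, hlE, hlM⟩ := exists_linearMap_glue f (LinearMap.id + h) E M (fun x hx hxM => by
    rw [LinearMap.add_apply, hhS x (Submodule.mem_sup_left ⟨hx, hxM⟩), hk₂E x ⟨hx, hxM⟩]
    simp)
  simp only [LinearMap.add_apply, LinearMap.id_apply] at hlM
  obtain ⟨g, hg, hgU⟩ := exists_isometry_extend_endo hchar hB hnd (E ⊔ M) l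
    (fun x hx hx0 => by
      obtain ⟨e, he, m, hm, rfl⟩ := Submodule.mem_sup.1 hx
      have h1 : f e ∈ M := by
        rw [map_add, hlE e he, hlM m hm] at hx0
        rw [eq_neg_of_add_eq_zero_left hx0]
        exact M.neg_mem (M.add_mem hm (hle (hhM m hm).1))
      have h2 := M.add_mem ((hM e he).2 h1) hm
      exact hhinj _ h2 (by rw [← hlM _ h2, hx0]))
    (fun x hx y hy => by
      obtain ⟨e, he, m, hm, rfl⟩ := Submodule.mem_sup.1 hx
      obtain ⟨d, hd, n, hn, rfl⟩ := Submodule.mem_sup.1 hy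
      have h1 : B (m + h m) (n + h n) = B m n := by
        simp only [map_add, LinearMap.add_apply, hMR0 m hm _ (hhM n hn).1,
          hMR0 _ (hle (hhM m hm).1) _ (hhM n hn).1, hB (h m) n, hMR0 n hn _ (hhM m hm).1, add_zero]
      have h2 : l (e + m) = f e + (m + h m) := by rw [map_add, hlE e he, hlM m hm]
      have h3 : l (d + n) = f d + (n + h n) := by rw [map_add, hlE d hd, hlM n hn]
      rw [h2, h3, map_add B, LinearMap.add_apply, map_add (B (f e)), map_add (B (m + h m)), h1,
        hhT n hn e he, hf e he d hd, hB (m + h m) (f d), hhT m hm d hd, hB d m]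
      simp only [map_add, LinearMap.add_apply]
      abel)
  refine ⟨g, hg, fun e he => ?_, fun x hx => ?_⟩
  · rw [hgU e (Submodule.mem_sup_left he), hlE e he]
  · rw [hgU x (Submodule.mem_sup_right hx), hlM x hx, add_sub_cancel_left]
    exact (hhM x hx).1

end WittExtension

section SubspacePair

variable {F V : Type*} [Field F] [AddCommGroup V] [Module F V] {B : LinearMap.BilinForm F V}

/-- A partial isometry `f` respecting the pair `A`, `P` of mutually orthogonal complements, and
inducing an isometry modulo `P` on `A`, extends to an isometry stabilising `A`. -/
theorem exists_isometry_extend_stabilising [FiniteDimensional F V] (hchar : (2 : F) ≠ 0)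
    (hB : ∀ u v, B u v = B v u) (hnd : B.Nondegenerate) {A P : Submodule F V}
    (hPA : P = B.orthogonal A) (E : Submodule F V) (f : V →ₗ[F] V)
    (hinj : ∀ x ∈ E, f x = 0 → x = 0) (hf : ∀ x ∈ E, ∀ y ∈ E, B (f x) (f y) = B x y)
    (hM : ∀ e ∈ E, e ∈ A ⊔ P ↔ f e ∈ A ⊔ P) (hA : ∀ e ∈ E, e ∈ A ↔ f e ∈ A)
    (hP : ∀ e ∈ E, e ∈ P ↔ f e ∈ P)
    (hφ : ∀ a₁ ∈ A, ∀ p₁ ∈ P, ∀ a₂ ∈ A, ∀ p₂ ∈ P, ∀ a₁' ∈ A, ∀ p₁' ∈ P, ∀ a₂' ∈ A, ∀ p₂' ∈ P,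
      a₁ + p₁ ∈ E → a₂ + p₂ ∈ E → f (a₁ + p₁) = a₁' + p₁' → f (a₂ + p₂) = a₂' + p₂' →
      B a₁' a₂' = B a₁ a₂) :
    ∃ g : V →ₗ[F] V, (∀ u v, B (g u) (g v) = B u v) ∧ (∀ e ∈ E, g e = f e) ∧
      ∀ a ∈ A, g a ∈ A := by
  have hAP : A = B.orthogonal P := by
    rw [hPA, LinearMap.BilinForm.orthogonal_orthogonal hnd (isRefl_of_symm hB)]
  have h0 : ∀ a ∈ A, ∀ p ∈ P, B a p = 0 := fun a ha p hp => by
    rw [hPA] at hp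
    exact hp a ha
  have hRM : A ⊓ P = B.orthogonal (A ⊔ P) := by
    ext x
    rw [LinearMap.BilinForm.mem_orthogonal_iff]
    constructor
    · rintro ⟨hxA, hxP⟩ y hy
      obtain ⟨a, ha, p, hp, rfl⟩ := Submodule.mem_sup.1 hy
      rw [map_add, LinearMap.add_apply, h0 a ha x hxP, hB p x, h0 x hxA p hp, add_zero]
    · intro h
      refine ⟨?_, ?_⟩
      · rw [hAP]
        exact fun p hp => h p (Submodule.mem_sup_right hp)
      · rw [hPA]
        exact fun a ha => h a (Submodule.mem_sup_left ha)
  have hMR : A ⊔ P = B.orthogonal (A ⊓ P) := by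
    rw [hRM, LinearMap.BilinForm.orthogonal_orthogonal hnd (isRefl_of_symm hB)]
  obtain ⟨G₁, hG₁, hG₁P, hG₁A, hG₁f⟩ := exists_isometry_fixing_orthogonal hchar hB hnd hAP E f
    (fun e he => (hM e he).1) hP hφ
  obtain ⟨G₂, hG₂, hG₂A, hG₂P, hG₂f⟩ := exists_isometry_fixing_orthogonal hchar hB hnd hPA E f
    (fun e he h => by rw [sup_comm] at h ⊢; exact (hM e he).1 h) hA (by
      intro p₁ hp₁ a₁ ha₁ p₂ hp₂ a₂ ha₂ p₁' hp₁' a₁' ha₁' p₂' hp₂' a₂' ha₂' hE₁ hE₂ hf₁ hf₂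
      have h1 := hf _ hE₁ _ hE₂
      rw [add_comm] at hE₁ hE₂
      rw [hf₁, hf₂] at h1
      rw [add_comm p₁, add_comm p₁'] at hf₁
      rw [add_comm p₂, add_comm p₂'] at hf₂
      have h2 := hφ a₁ ha₁ p₁ hp₁ a₂ ha₂ p₂ hp₂ a₁' ha₁' p₁' hp₁' a₂' ha₂' p₂' hp₂' hE₁ hE₂ hf₁ hf₂
      simp only [map_add, LinearMap.add_apply, h0 _ ha₁ _ hp₂, h0 _ ha₁' _ hp₂', hB p₁ a₂,
        hB p₁' a₂', h0 _ ha₂ _ hp₁, h0 _ ha₂' _ hp₁', h2] at h1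
      linear_combination h1)
  have hGiso : ∀ u v, B ((G₁ ∘ₗ G₂) u) ((G₁ ∘ₗ G₂) v) = B u v := fun u v =>
    (hG₁ _ _).trans (hG₂ u v)
  have hGinj := injective_of_isometry hnd hGiso
  let G : V ≃ₗ[F] V := LinearEquiv.ofInjectiveEndo _ hGinj
  have hG : ∀ x, G x = G₁ (G₂ x) := fun _ => rfl
  have hGA : ∀ x ∈ A, G x ∈ A := fun x hx => by rw [hG, hG₂A x hx]; exact hG₁A x hx
  have hGP : ∀ x ∈ P, G x ∈ P := fun x hx => by rw [hG, hG₁P _ (hG₂P x hx)]; exact hG₂P x hx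
  have hGM : ∀ x ∈ A ⊔ P, G x ∈ A ⊔ P := fun x hx => by
    obtain ⟨a, ha, p, hp, rfl⟩ := Submodule.mem_sup.1 hx
    rw [map_add]
    exact Submodule.add_mem_sup (hGA a ha) (hGP p hp)
  have hsymm : ∀ S : Submodule F V, (∀ x ∈ S, G x ∈ S) → ∀ x ∈ S, G.symm x ∈ S := by
    intro S hS x hx
    rw [← map_eq_of_injective_of_forall_mem G.toLinearMap G.injective S hS] at hx
    obtain ⟨y, hy, rfl⟩ := hx
    rwa [LinearEquiv.coe_coe, G.symm_apply_apply]
  obtain ⟨g, hg, hgE, hgM⟩ := exists_isometry_extend_of_sub_mem hchar hB hnd hRM hMR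
    (inf_le_left.trans le_sup_left) E (G.symm.toLinearMap ∘ₗ f)
    (fun x hx h => hinj x hx (G.symm.map_eq_zero_iff.1 h))
    (fun x hx y hy => by
      rw [← hf x hx y hy, ← hGiso]
      exact congrArg₂ (fun u v => B u v) (G.apply_symm_apply _) (G.apply_symm_apply _))
    (fun e he => by
      rw [hM e he]
      refine ⟨hsymm _ hGM _, fun h => ?_⟩
      have := hGM _ h
      rwa [LinearMap.comp_apply, LinearEquiv.coe_coe, G.apply_symm_apply] at this)
    (fun e he heM => by
      have h1 : f e - G e ∈ A ⊓ P := by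
        obtain ⟨a', ha', p', hp', hap'⟩ := Submodule.mem_sup.1 ((hM e he).1 heM)
        obtain ⟨a, ha, p, hp, rfl⟩ := Submodule.mem_sup.1 heM
        have h2 : f (a + p) - G (a + p) = -((G₁ a - a') + (G₂ p - p')) := by
          rw [hG, map_add G₂, hG₂A a ha, map_add G₁, hG₁P _ (hG₂P p hp), ← hap']
          abel
        have h3 : G₁ a - a' ∈ A ⊓ P := ⟨A.sub_mem (hG₁A a ha) ha',
          hG₁f a ha p hp a' ha' p' hp' he hap'.symm⟩
        have h4 : G₂ p - p' ∈ A ⊓ P := ⟨hG₂f p hp a ha p' hp' a' ha' (by rwa [add_comm])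
          (by rw [add_comm p, add_comm p', hap']), P.sub_mem (hG₂P p hp) hp'⟩
        rw [h2]
        exact Submodule.neg_mem _ (Submodule.add_mem _ h3 h4)
      have h5 := hsymm (A ⊓ P) (fun x hx => ⟨hGA x hx.1, hGP x hx.2⟩) _ h1
      rwa [map_sub, G.symm_apply_apply] at h5)
  refine ⟨G.toLinearMap ∘ₗ g, fun u v => (hGiso _ _).trans (hg u v), fun e he => ?_,
    fun a ha => hGA _ ?_⟩
  · rw [LinearMap.comp_apply, hgE e he]
    exact G.apply_symm_apply _
  · have := A.add_mem (hgM a (Submodule.mem_sup_left ha)).1 ha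
    rwa [sub_add_cancel] at this

variable {V' : Type*} [AddCommGroup V'] [Module F V'] {B' : LinearMap.BilinForm F V'}

theorem map_orthogonal_of_isometry (θ : V ≃ₗ[F] V') (hθ : ∀ u v, B' (θ u) (θ v) = B u v)
    (A : Submodule F V) :
    (B.orthogonal A).map θ.toLinearMap = B'.orthogonal (A.map θ.toLinearMap) := by
  ext x
  obtain ⟨y, rfl⟩ := θ.surjective x
  rw [LinearMap.BilinForm.mem_orthogonal_iff]
  constructor
  · rintro ⟨z, hz, hzy⟩ _ ⟨a, ha, rfl⟩
    rw [← θ.injective hzy]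
    exact (hθ a z).trans (hz a ha)
  · intro h
    exact ⟨y, fun a ha => (hθ a y).symm.trans (h _ ⟨a, ha, rfl⟩), rfl⟩

end SubspacePair

/-- Theorem 5.3 (main theorem): an isometry `φ : E → E'` extends to an
isometry `φ_V : V → V'` sending `A` to `A'` iff (C2), (C3), (C4) hold and the
induced linear bijection `φ_A` on the quotients is an isometry for the
induced forms. -/
theorem witt_extension_subspace_pair {F V V' : Type*} [Field F]
    [AddCommGroup V] [Module F V] [AddCommGroup V'] [Module F V']
    [FiniteDimensional F V] [FiniteDimensional F V']
    (hchar : (2 : F) ≠ 0)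
    (B : LinearMap.BilinForm F V) (B' : LinearMap.BilinForm F V')
    (hB : ∀ u v : V, B u v = B v u) (hB' : ∀ u v : V', B' u v = B' v u)
    (hnd : B.Nondegenerate) (hnd' : B'.Nondegenerate)
    (hVV' : AreIsometric B B')
    (E A : Submodule F V) (E' A' : Submodule F V')
    (hAA' : SubIsometric B B' A A')
    (φ : E ≃ₗ[F] E') (hφ : IsIsometryOn B B' E E' φ) :
    (∃ φV : V ≃ₗ[F] V', IsIsometry B B' φV ∧
        (∀ e : E, φV (e : V) = (φ e : V')) ∧ A.map φV.toLinearMap = A') ↔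
      ((∀ e : E, (e : V) ∈ A ⊔ B.orthogonal A ↔
          (φ e : V') ∈ A' ⊔ B'.orthogonal A') ∧
       (∀ e : E, (e : V) ∈ A ↔ (φ e : V') ∈ A') ∧
       (∀ e : E, (e : V) ∈ B.orthogonal A ↔ (φ e : V') ∈ B'.orthogonal A') ∧
       ∃ ψ : (↥((E ⊔ B.orthogonal A) ⊓ A) ⧸
               (B.orthogonal A ⊓ A).comap ((E ⊔ B.orthogonal A) ⊓ A).subtype)
           ≃ₗ[F] (↥((E' ⊔ B'.orthogonal A') ⊓ A') ⧸
               (B'.orthogonal A' ⊓ A').comap ((E' ⊔ B'.orthogonal A') ⊓ A').subtype),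
         -- `ψ` is the induced map `φ_A`
         (∀ (v : V) (hvW : v ∈ (E ⊔ B.orthogonal A) ⊓ A)
            (e : V) (he : e ∈ E) (a : V), a ∈ B.orthogonal A → v = e - a →
            ∀ (v' : V') (hvW' : v' ∈ (E' ⊔ B'.orthogonal A') ⊓ A')
              (a' : V'), a' ∈ B'.orthogonal A' → (φ ⟨e, he⟩ : V') = v' + a' →
            ψ (Submodule.Quotient.mk ⟨v, hvW⟩) =
              Submodule.Quotient.mk ⟨v', hvW'⟩) ∧
         -- `ψ` is an isometry with respect to the induced forms `b̄`, `b̄'`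
         (∀ (w₁ w₂ : ↥((E ⊔ B.orthogonal A) ⊓ A))
            (w₁' w₂' : ↥((E' ⊔ B'.orthogonal A') ⊓ A')),
            ψ (Submodule.Quotient.mk w₁) = Submodule.Quotient.mk w₁' →
            ψ (Submodule.Quotient.mk w₂) = Submodule.Quotient.mk w₂' →
            B' (w₁' : V') (w₂' : V') = B (w₁ : V) (w₂ : V))) := by
  have hmem : ∀ (θ : V ≃ₗ[F] V') (S : Submodule F V) (x : V),
      θ x ∈ S.map θ.toLinearMap ↔ x ∈ S := fun θ S x =>
    ⟨fun ⟨y, hy, h⟩ => θ.injective h ▸ hy, fun h => ⟨x, h, rfl⟩⟩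
  constructor
  · rintro ⟨θ, hθ, hθE, rfl⟩
    have horth := map_orthogonal_of_isometry θ hθ A
    have hEmap : E.map θ.toLinearMap = E' := by
      ext x
      constructor
      · rintro ⟨e, he, rfl⟩
        exact (hθE ⟨e, he⟩).symm ▸ (φ ⟨e, he⟩).2
      · intro hx
        refine ⟨φ.symm ⟨x, hx⟩, Subtype.coe_prop _, ?_⟩
        have := hθE (φ.symm ⟨x, hx⟩)
        rwa [φ.apply_symm_apply] at this
    have hD : ((E ⊔ B.orthogonal A) ⊓ A).map θ.toLinearMap =
        (E' ⊔ B'.orthogonal (A.map θ.toLinearMap)) ⊓ A.map θ.toLinearMap := by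
      rw [Submodule.map_inf _ θ.injective, Submodule.map_sup, hEmap, horth]
    refine ⟨fun e => ?_, fun e => ?_, fun e => ?_, ?_⟩
    · rw [← hθE, ← horth, ← Submodule.map_sup, hmem]
    · rw [← hθE, hmem]
    · rw [← hθE, ← horth, hmem]
    · let δ := (θ.submoduleMap ((E ⊔ B.orthogonal A) ⊓ A)).trans (LinearEquiv.ofEq _ _ hD)
      have hδ : ∀ w, (δ w : V') = θ w := fun _ => rfl
      let p := (B.orthogonal A ⊓ A).comap ((E ⊔ B.orthogonal A) ⊓ A).subtype
      let q := (B'.orthogonal (A.map θ.toLinearMap) ⊓ A.map θ.toLinearMap).comap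
        ((E' ⊔ B'.orthogonal (A.map θ.toLinearMap)) ⊓ A.map θ.toLinearMap).subtype
      have hpq : p.map δ.toLinearMap = q := by
        ext x
        obtain ⟨w, rfl⟩ := δ.surjective x
        have h1 : δ w ∈ q ↔ w ∈ p := by
          simp only [p, q, Submodule.mem_comap, Submodule.subtype_apply, hδ, Submodule.mem_inf,
            ← horth, hmem]
        rw [h1]
        exact ⟨fun ⟨y, hy, h⟩ => δ.injective h ▸ hy, fun h => ⟨w, h, rfl⟩⟩
      refine ⟨Submodule.Quotient.equiv p q δ hpq, ?_, ?_⟩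
      · intro v hv e he a ha hvea v' hv' a' ha' hφe
        refine (Submodule.Quotient.eq q).2 ?_
        have h1 : θ v ∈ A.map θ.toLinearMap := (hmem θ A v).2 hv.2
        have h2 : θ a ∈ B'.orthogonal (A.map θ.toLinearMap) := by
          rw [← horth, hmem]
          exact ha
        have h3 : θ v - v' = a' - θ a := by
          rw [hvea, map_sub, hθE ⟨e, he⟩, hφe]
          abel
        refine ⟨?_, Submodule.sub_mem _ h1 hv'.2⟩
        change θ v - v' ∈ _
        rw [h3]
        exact Submodule.sub_mem _ ha' h2
      · intro w₁ w₂ w₁' w₂' h₁ h₂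
        have h₁' := (Submodule.Quotient.eq q).1 h₁
        have h₂' := (Submodule.Quotient.eq q).1 h₂
        have e₁ : B' (θ w₁ - w₁') (w₂' : V') = 0 := by
          rw [hB']
          exact h₁'.1 _ w₂'.2.2
        have e₂ : B' (θ w₁) (θ w₂ - w₂') = 0 :=
          h₂'.1 _ ((hmem θ A w₁).2 w₁.2.2)
        rw [map_sub, LinearMap.sub_apply] at e₁
        rw [map_sub, hθ] at e₂
        linear_combination -e₁ - e₂
  · rintro ⟨hM, hA, hP, ψ, hψ, hψiso⟩
    obtain ⟨ψ₀, hψ₀⟩ := hVV'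
    obtain ⟨α, hα⟩ := hAA'
    obtain ⟨f₀, hf₀⟩ := (A'.subtype ∘ₗ α.toLinearMap).exists_extend
    have hf₀A : ∀ x (hx : x ∈ A), f₀ x = α ⟨x, hx⟩ := fun x hx => LinearMap.congr_fun hf₀ ⟨x, hx⟩
    obtain ⟨θ, hθ, hθA⟩ := exists_isometry_extend hchar hB hnd ψ₀ hψ₀ A f₀
      (fun x hx h => by
        rw [hf₀A x hx] at h
        exact congrArg Subtype.val (α.map_eq_zero_iff.1 (Subtype.ext h)))
      (fun x hx y hy => by rw [hf₀A x hx, hf₀A y hy, hα])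
    obtain rfl : A.map θ.toLinearMap = A' := by
      ext x
      constructor
      · rintro ⟨a, ha, rfl⟩
        rw [LinearEquiv.coe_coe, hθA a ha, hf₀A a ha]
        exact Subtype.coe_prop _
      · intro hx
        refine ⟨α.symm ⟨x, hx⟩, Subtype.coe_prop _, ?_⟩
        rw [LinearEquiv.coe_coe, hθA _ (Subtype.coe_prop _), hf₀A _ (Subtype.coe_prop _),
          Subtype.coe_eta, α.apply_symm_apply]
    have horth := map_orthogonal_of_isometry θ hθ A
    obtain ⟨f, hf⟩ := (E'.subtype ∘ₗ φ.toLinearMap).exists_extend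
    have hfE : ∀ x (hx : x ∈ E), f x = φ ⟨x, hx⟩ := fun x hx => LinearMap.congr_fun hf ⟨x, hx⟩
    have hθf : ∀ x, θ ((θ.symm.toLinearMap ∘ₗ f) x) = f x := fun x => θ.apply_symm_apply _
    obtain ⟨g, hg, hgE, hgA⟩ := exists_isometry_extend_stabilising hchar hB hnd rfl E
      (θ.symm.toLinearMap ∘ₗ f)
      (fun x hx h => by
        have h1 : f x = 0 := θ.symm.map_eq_zero_iff.1 h
        rw [hfE x hx] at h1
        exact congrArg Subtype.val (φ.map_eq_zero_iff.1 (Subtype.ext h1)))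
      (fun x hx y hy => by rw [← hθ, hθf, hθf, hfE x hx, hfE y hy, hφ])
      (fun e he => by
        rw [hM ⟨e, he⟩, ← hfE e he, ← horth, ← Submodule.map_sup, ← hθf, hmem])
      (fun e he => by rw [hA ⟨e, he⟩, ← hfE e he, ← hθf, hmem])
      (fun e he => by rw [hP ⟨e, he⟩, ← hfE e he, ← horth, ← hθf, hmem])
      (by
        have key : ∀ a ∈ A, ∀ p ∈ B.orthogonal A, ∀ a' ∈ A, ∀ p' ∈ B.orthogonal A, a + p ∈ E →
            (θ.symm.toLinearMap ∘ₗ f) (a + p) = a' + p' →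
            ∃ (h : a ∈ (E ⊔ B.orthogonal A) ⊓ A)
              (h' : θ a' ∈ (E' ⊔ B'.orthogonal (A.map θ.toLinearMap)) ⊓ A.map θ.toLinearMap),
              ψ (Submodule.Quotient.mk ⟨a, h⟩) = Submodule.Quotient.mk ⟨θ a', h'⟩ := by
          intro a ha p hp a' ha' p' hp' hE h
          have h1 : (φ ⟨a + p, hE⟩ : V') = θ a' + θ p' := by
            rw [← hfE, ← hθf, h, map_add]
          have h2 : θ p' ∈ B'.orthogonal (A.map θ.toLinearMap) := by
            rw [← horth, hmem]
            exact hp'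
          have h3 : a = a + p - p := (add_sub_cancel_right a p).symm
          have h4 : θ a' = φ ⟨a + p, hE⟩ - θ p' := by rw [h1, add_sub_cancel_right]
          have h5 : a ∈ E ⊔ B.orthogonal A := by
            rw [h3]
            exact Submodule.sub_mem _ (Submodule.mem_sup_left hE) (Submodule.mem_sup_right hp)
          have h6 : θ a' ∈ E' ⊔ B'.orthogonal (A.map θ.toLinearMap) := by
            rw [h4]
            exact Submodule.sub_mem _ (Submodule.mem_sup_left (Subtype.coe_prop _))
              (Submodule.mem_sup_right h2)
          exact ⟨⟨h5, ha⟩, ⟨h6, (hmem θ A a').2 ha'⟩,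
            hψ a _ (a + p) hE p hp h3 (θ a') _ (θ p') h2 h1⟩
        intro a₁ ha₁ p₁ hp₁ a₂ ha₂ p₂ hp₂ a₁' ha₁' p₁' hp₁' a₂' ha₂' p₂' hp₂' hE₁ hE₂ hf₁ hf₂
        obtain ⟨h₁, h₁', hψ₁⟩ := key a₁ ha₁ p₁ hp₁ a₁' ha₁' p₁' hp₁' hE₁ hf₁
        obtain ⟨h₂, h₂', hψ₂⟩ := key a₂ ha₂ p₂ hp₂ a₂' ha₂' p₂' hp₂' hE₂ hf₂
        rw [← hθ]
        exact hψiso _ _ _ _ hψ₁ hψ₂)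
    have hginj := injective_of_isometry hnd hg
    refine ⟨(LinearEquiv.ofInjectiveEndo g hginj).trans θ, fun u v => (hθ _ _).trans (hg u v),
      fun e => ?_, ?_⟩
    · have : θ (g e) = φ e := by rw [hgE e e.2, hθf, hfE e e.2]
      exact this
    · rw [LinearEquiv.coe_trans, Submodule.map_comp]
      exact congrArg _ (map_eq_of_injective_of_forall_mem g hginj A hgA)
end

section
/- Let (V,b) ≈ (V',b') be nonsingular finite-dimensional metric spaces over F. Let E, A ⊆ V and E', A' ⊆ V' be subspaces satisfying A ≈ A', (E+A^⊥) ∩ A = E ∩ A and (E'+A'^⊥) ∩ A' = E' ∩ A'. Then an isometry φ : E → E' can be extended to an isometry φ_V : V → V' that also sends A to A' if and only if φ(E ∩ A) = E' ∩ A' and φ(E ∩ A^⊥) = E' ∩ A'^⊥. -/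
open Module

open Module Witt

namespace Witt

section Auxiliary

variable {F V : Type*} [Field F] [AddCommGroup V] [Module F V]

/-- A functional lies in the range of `T : M → N*` as soon as it kills every vector killed by
all of the range. -/
lemma exists_apply_eq_of_forall_eq_zero {M N : Type*} [AddCommGroup M] [Module F M]
    [AddCommGroup N] [Module F N] [FiniteDimensional F N] (T : M →ₗ[F] Dual F N) (f : Dual F N)
    (h : ∀ n, (∀ m, T m n = 0) → f n = 0) : ∃ m, T m = f := by
  have hf : f ∈ (LinearMap.range T).dualCoannihilator.dualAnnihilator := by
    rw [Submodule.mem_dualAnnihilator]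
    intro n hn
    rw [Submodule.mem_dualCoannihilator] at hn
    exact h n fun m => hn _ ⟨m, rfl⟩
  rwa [Subspace.dualCoannihilator_dualAnnihilator_eq] at hf

/-- A linear map over a field has a linear section over its range, defined on the whole
codomain. -/
lemma exists_section_on_range {M N : Type*} [AddCommGroup M] [Module F M]
    [AddCommGroup N] [Module F N] (T : M →ₗ[F] N) :
    ∃ s : N →ₗ[F] M, ∀ y ∈ LinearMap.range T, T (s y) = y := by
  obtain ⟨s, hs⟩ := T.rangeRestrict.exists_rightInverse_of_surjective T.range_rangeRestrict
  obtain ⟨s', hs'⟩ := LinearMap.exists_extend s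
  refine ⟨s', fun y hy => ?_⟩
  have h : s' y = s ⟨y, hy⟩ := LinearMap.congr_fun hs' ⟨y, hy⟩
  rw [h]
  exact congrArg Subtype.val (LinearMap.congr_fun hs ⟨y, hy⟩)

/-- Two vectors outside a subspace `H` are separated from `H` by a common functional. -/
lemma exists_dual_ne_zero_of_notMem (H : Submodule F V) {v w : V} (hv : v ∉ H) (hw : w ∉ H) :
    ∃ f : Dual F V, (∀ x ∈ H, f x = 0) ∧ f v ≠ 0 ∧ f w ≠ 0 := by
  obtain ⟨f, hfv, hf⟩ := Submodule.exists_le_ker_of_notMem hv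
  obtain ⟨g, hgw, hg⟩ := Submodule.exists_le_ker_of_notMem hw
  have hf' : ∀ x ∈ H, f x = 0 := fun x hx => hf hx
  have hg' : ∀ x ∈ H, g x = 0 := fun x hx => hg hx
  by_cases h1 : f w = 0
  · by_cases h2 : g v = 0
    · exact ⟨f + g, fun x hx => by simp [hf' x hx, hg' x hx], by simpa [h2], by simpa [h1]⟩
    · exact ⟨g, hg', h2, hgw⟩
  · exact ⟨f, hf', hfv, h1⟩

variable {B : LinearMap.BilinForm F V}

/-- A form-preserving endomorphism that is injective on the radical is injective. -/
lemma injective_of_isometric {g : V →ₗ[F] V} (hg : ∀ x y, B (g x) (g y) = B x y)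
    (hker : ∀ x, B x = 0 → g x = 0 → x = 0) : Function.Injective g := by
  rw [injective_iff_map_eq_zero]
  refine fun x hx => hker x ?_ hx
  ext y
  rw [← hg, hx]
  simp

/-- Given two vectors of equal length outside a subspace `H` containing the radical and having
the same products with `H`, some isometry fixes `H` pointwise and carries one to the other. -/
lemma exists_isometric_fixing_apply_eq [FiniteDimensional F V] (hchar : (2 : F) ≠ 0)
    (hB : ∀ u v, B u v = B v u) (H : Submodule F V) (hH : ∀ x, B x = 0 → x ∈ H) {v w : V}
    (hv : v ∉ H) (hw : w ∉ H) (hvw : B v v = B w w) (hHvw : ∀ x ∈ H, B x v = B x w) :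
    ∃ g : V →ₗ[F] V, Function.Injective g ∧ (∀ x y, B (g x) (g y) = B x y) ∧
      (∀ x ∈ H, g x = x) ∧ g v = w := by
  suffices h : ∃ g : V →ₗ[F] V, (∀ x y, B (g x) (g y) = B x y) ∧
      (∀ x ∈ H, g x = x) ∧ g v = w by
    obtain ⟨g, h1, h2, h3⟩ := h
    exact ⟨g, injective_of_isometric h1 fun x hx hgx => (h2 x (hH x hx)).symm.trans hgx,
      h1, h2, h3⟩
  have hHu : ∀ x ∈ H, B x (w - v) = 0 := fun x hx => by simp [hHvw x hx]
  have hvu : 2 * B v (w - v) = - B (w - v) (w - v) := by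
    simp only [map_sub, LinearMap.sub_apply, hB w v, hvw]
    ring
  have hwv : w = v + (w - v) := by abel
  generalize w - v = u at *
  by_cases hu : B u u = 0
  · have hvu0 : B v u = 0 := by simpa [hu, hchar] using hvu
    obtain ⟨f, hf, hfv, hfw⟩ := exists_dual_ne_zero_of_notMem H hv hw
    obtain ⟨m, hm⟩ := exists_apply_eq_of_forall_eq_zero B ((f v)⁻¹ • f) fun n hn => by
      have : n ∈ H := hH n (by ext y; rw [hB]; exact hn y)
      simp [hf n this]
    have hm' : ∀ x, B m x = (f v)⁻¹ * f x := fun x => by simp [hm]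
    have hmH : ∀ x ∈ H, B x m = 0 := fun x hx => by rw [hB, hm', hf x hx, mul_zero]
    have hvm : B v m = 1 := by rw [hB, hm', inv_mul_cancel₀ hfv]
    have hum : 1 + B u m ≠ 0 := by
      have : 1 + B u m = (f v)⁻¹ * f w := by
        rw [← hvm, ← hm', hB m w, hwv]
        simp
      rw [this]
      exact mul_ne_zero (inv_ne_zero hfv) hfw
    obtain ⟨s, hs⟩ : ∃ s : F, s * (1 + B u m) = -1 :=
      ⟨-(1 + B u m)⁻¹, by rw [neg_mul, inv_mul_cancel₀ hum]⟩
    obtain ⟨t, ht⟩ : ∃ t : F, 2 * t = s * B m m := ⟨s * B m m / 2, by field_simp⟩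
    refine ⟨LinearMap.id + (B m).smulRight u + (B u).smulRight (s • m + t • u),
      fun x y => ?_, fun x hx => ?_, ?_⟩
    · simp only [LinearMap.add_apply, LinearMap.id_apply, LinearMap.smulRight_apply,
        map_add, map_smul, LinearMap.smul_apply, smul_eq_mul, hu, hB x u, hB x m, hB m u]
      linear_combination (B m x * B u y + B u x * B m y + 2 * t * B u x * B u y) * hs -
        s * B u x * B u y * ht
    · simp [hB m x, hB u x, hmH x hx, hHu x hx]
    · simp [hB m v, hB u v, hvm, hvu0, hwv]
  · refine ⟨LinearMap.id + (B u).smulRight ((-2 / B u u) • u), fun x y => ?_,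
      fun x hx => ?_, ?_⟩
    · simp only [LinearMap.add_apply, LinearMap.id_apply, LinearMap.smulRight_apply,
        map_add, map_smul, LinearMap.smul_apply, smul_eq_mul, hB x u]
      field_simp
      ring
    · simp [hB u x, hHu x hx]
    · have : B v u * (-2 / B u u) = 1 := by
        field_simp
        linear_combination -hvu
      simp [hB u v, smul_smul, this, hwv]

/-- Witt's extension theorem for a possibly degenerate form, for subspaces containing the
radical. -/
lemma exists_isometric_extension [FiniteDimensional F V] (hchar : (2 : F) ≠ 0)
    (hB : ∀ u v, B u v = B v u) (D : Submodule F V) (hD : LinearMap.ker B ≤ D) (σ : D →ₗ[F] V)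
    (hinj : Function.Injective σ) (hσ : ∀ x y, B (σ x) (σ y) = B x y)
    (hrad : ∀ x : D, B x = 0 → B (σ x) = 0) :
    ∃ g : V →ₗ[F] V, Function.Injective g ∧ (∀ x y, B (g x) (g y) = B x y) ∧
      ∀ x : D, g x = σ x := by
  let S : Set (Submodule F V) := {H | LinearMap.ker B ≤ H ∧ H ≤ D ∧ ∃ g : V →ₗ[F] V,
    Function.Injective g ∧ (∀ x y, B (g x) (g y) = B x y) ∧ ∀ x : D, (x : V) ∈ H → g x = σ x}
  have hbase : LinearMap.ker B ∈ S := by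
    let τ : LinearMap.ker B →ₗ[F] LinearMap.ker B :=
      (σ ∘ₗ Submodule.inclusion hD).codRestrict _ (fun x => hrad (Submodule.inclusion hD x) x.2) - LinearMap.id
    obtain ⟨τ', hτ'⟩ := LinearMap.exists_extend τ
    have hτ0 : ∀ x y, B (τ' x) y = 0 := fun x y => by
      have : B (τ' x) = 0 := (τ' x).2
      simp [this]
    have hτ : ∀ x : D, B x = 0 → (x : V) + τ' x = σ x := fun x hx => by
      have h : τ' x = τ ⟨x, hx⟩ := LinearMap.congr_fun hτ' ⟨(x : V), hx⟩
      rw [h]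
      change (x : V) + (σ x - x) = σ x
      abel
    have hg : ∀ x y, B ((LinearMap.id + (LinearMap.ker B).subtype ∘ₗ τ' : V →ₗ[F] V) x)
        ((LinearMap.id + (LinearMap.ker B).subtype ∘ₗ τ' : V →ₗ[F] V) y) = B x y := fun x y => by
      simp [hB x (τ' y)]
    refine ⟨le_rfl, hD, _, injective_of_isometric hg fun x hx h0 => ?_, hg, fun x hx => hτ x hx⟩
    have h1 : σ ⟨x, hD hx⟩ = 0 := (hτ ⟨x, hD hx⟩ hx).symm.trans h0
    simpa using congrArg Subtype.val ((injective_iff_map_eq_zero σ).1 hinj _ h1)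
  obtain ⟨H, ⟨hH, hHD, g, hg1, hg2, hg3⟩, hmax⟩ :=
    (wellFounded_gt (α := Submodule F V)).has_min S ⟨_, hbase⟩
  suffices h : D ≤ H from ⟨g, hg1, hg2, fun x => hg3 x (h x.2)⟩
  by_contra hle
  obtain ⟨v, hvD, hvH⟩ := SetLike.not_le_iff_exists.1 hle
  obtain ⟨w, hw⟩ := LinearMap.surjective_of_injective hg1 (σ ⟨v, hvD⟩)
  obtain ⟨k, hk1, hk2, hk3, hk4⟩ := exists_isometric_fixing_apply_eq hchar hB H hH
    (v := v) (w := w) hvH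
    (fun hwH => hvH (by
      have h : (⟨w, hHD hwH⟩ : D) = ⟨v, hvD⟩ := hinj (by rw [← hw, ← hg3 _ hwH])
      obtain rfl : w = v := congrArg Subtype.val h
      exact hwH))
    (by rw [← hg2 w w, hw, hσ])
    (fun x hx => by rw [← hg2 x w, hw, hg3 ⟨x, hHD hx⟩ hx, hσ])
  refine hmax (H ⊔ F ∙ v) ⟨hH.trans le_sup_left, sup_le hHD (by simpa), g ∘ₗ k,
    hg1.comp hk1, fun x y => by simp [hg2, hk2], ?_⟩ ?_
  · rintro ⟨x, hxD⟩ hx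
    obtain ⟨y, hy, z, hz, hyz⟩ := Submodule.mem_sup.1 hx
    obtain ⟨c, rfl⟩ := Submodule.mem_span_singleton.1 hz
    have : (⟨x, hxD⟩ : D) = ⟨y, hHD hy⟩ + c • ⟨v, hvD⟩ := Subtype.ext hyz.symm
    rw [this, map_add, map_smul, ← hg3 ⟨y, hHD hy⟩ hy, ← hw]
    simp [hk3 y hy, hk4]
  · refine lt_of_le_of_ne le_sup_left fun h => hvH ?_
    rw [h]
    exact Submodule.mem_sup_right (Submodule.mem_span_singleton_self v)

variable {V' : Type*} [AddCommGroup V'] [Module F V'] {B' : LinearMap.BilinForm F V'}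

/-- A vector of `E` orthogonal to the radical of `A` is the sum of a vector of `E ∩ A` and a
vector of `E ∩ A^⊥`, provided `(E + A^⊥) ∩ A = E ∩ A`. -/
lemma exists_mem_sub_mem_orthogonal [FiniteDimensional F V] (hB : ∀ u v, B u v = B v u)
    {E A : Submodule F V} (hEA : (E ⊔ B.orthogonal A) ⊓ A = E ⊓ A) {e : V} (he : e ∈ E)
    (h : ∀ r ∈ A, r ∈ B.orthogonal A → B e r = 0) :
    ∃ a ∈ E ⊓ A, e - a ∈ E ⊓ B.orthogonal A := by
  obtain ⟨a, ha⟩ := exists_apply_eq_of_forall_eq_zero (B.domRestrict₁₂ A A)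
    (B e ∘ₗ A.subtype) fun r hr => h r r.2 fun x hx => hr ⟨x, hx⟩
  have hea : e - a ∈ B.orthogonal A := fun x hx => by
    have : B a x = B e x := LinearMap.congr_fun ha ⟨x, hx⟩
    change B x (e - a) = 0
    rw [hB, map_sub, LinearMap.sub_apply, this, sub_self]
  have haE : (a : V) ∈ E ⊓ A := by
    rw [← hEA]
    refine ⟨?_, a.2⟩
    rw [← sub_sub_cancel e (a : V)]
    exact sub_mem (Submodule.mem_sup_left he) (Submodule.mem_sup_right hea)
  exact ⟨a, haE, sub_mem he haE.1, hea⟩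

/-- Under the hypotheses of the extension theorem for pairs, there is an isometry from `A` into
`A'` that is compatible with the isometry given on `E`. -/
lemma exists_compatible_isometry [FiniteDimensional F V] (hchar : (2 : F) ≠ 0)
    (hB : ∀ u v, B u v = B v u) (hB' : ∀ u v, B' u v = B' v u) {E A : Submodule F V}
    {A' : Submodule F V'} (hAA' : SubIsometric B B' A A')
    (hEA : (E ⊔ B.orthogonal A) ⊓ A = E ⊓ A) (φ : E →ₗ[F] V') (hinj : Function.Injective φ)
    (hφ : ∀ x y, B' (φ x) (φ y) = B x y) (hA : ∀ e : E, (e : V) ∈ A → φ e ∈ A')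
    (hAo : ∀ e : E, (e : V) ∈ B.orthogonal A → φ e ∈ B'.orthogonal A') :
    ∃ α : A →ₗ[F] V', Function.Injective α ∧ (∀ a, α a ∈ A') ∧
      (∀ x y, B' (α x) (α y) = B x y) ∧ (∀ (e : E) (a : A), B' (φ e) (α a) = B e a) ∧
      ∀ (e : E) (a : A), (e : V) = a → φ e = α a := by
  obtain ⟨ψ, hψ⟩ := hAA'
  have hradE : ∀ r ∈ A, r ∈ B.orthogonal A → r ∈ E := fun r hr hro =>
    (hEA.le ⟨Submodule.mem_sup_right hro, hr⟩).1
  have hψs : ∀ x y : A', B (ψ.symm x) (ψ.symm y) = B' x y := fun x y => by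
    rw [← hψ, ψ.apply_symm_apply, ψ.apply_symm_apply]
  -- the isometry of `E ∩ A` into `A` induced by `φ`, extended to all of `A`
  let κ : E.comap A.subtype →ₗ[F] E :=
    (A.subtype ∘ₗ (E.comap A.subtype).subtype).codRestrict E fun x => x.2
  let φA : E.comap A.subtype →ₗ[F] A' := (φ ∘ₗ κ).codRestrict A' fun x => hA (κ x) x.1.2
  obtain ⟨g, -, hg2, hg3⟩ := exists_isometric_extension (B := B.domRestrict₁₂ A A) hchar
    (fun x y => hB x y) (E.comap A.subtype)
    (fun r hr => hradE r r.2 fun x hx => by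
      change B x r = 0
      rw [hB]
      exact LinearMap.congr_fun hr ⟨x, hx⟩)
    (ψ.symm.toLinearMap ∘ₗ φA)
    (fun x y hxy => by
      have h1 : φ (κ x) = φ (κ y) := congrArg Subtype.val (ψ.symm.injective hxy)
      have h2 : (κ x : V) = κ y := congrArg Subtype.val (hinj h1)
      exact Subtype.ext (Subtype.ext h2))
    (fun x y => (hψs _ _).trans (hφ _ _))
    (fun x hx => by
      ext y
      have h1 : φ (κ x) ∈ B'.orthogonal A' := hAo _ fun z hz => by
        change B z x = 0
        rw [hB]
        exact LinearMap.congr_fun hx ⟨z, hz⟩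
      change B (ψ.symm (φA x)) y = 0
      rw [← ψ.symm_apply_apply y, hψs, hB']
      exact h1 _ (ψ y).2)
  let α₀ : A →ₗ[F] V' := A'.subtype ∘ₗ ψ.toLinearMap ∘ₗ g
  have hα₀mem : ∀ a, α₀ a ∈ A' := fun a => (ψ (g a)).2
  have hα₀ : ∀ x y, B' (α₀ x) (α₀ y) = B x y := fun x y => (hψ _ _).trans (hg2 x y)
  have hα₀E : ∀ (e : E) (a : A), (e : V) = a → φ e = α₀ a := fun e a hea => by
    have h1 : g a = ψ.symm (φA ⟨a, show (a : V) ∈ E from hea ▸ e.2⟩) := hg3 ⟨a, _⟩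
    change φ e = ψ (g a)
    rw [h1, ψ.apply_symm_apply]
    exact congrArg φ (Subtype.ext hea)
  -- the failure of compatibility of `α₀` with `φ` is represented by radical vectors
  let R : Submodule F V := A ⊓ B.orthogonal A
  have hRE : R ≤ E := fun r hr => hradE r hr.1 hr.2
  let T : R →ₗ[F] Dual F E := B.domRestrict₁₂ R E
  let δ : A →ₗ[F] Dual F E := B.domRestrict₁₂ A E - (B'.compl₂ φ) ∘ₗ α₀
  have hδ : ∀ a e, δ a e = B e a - B' (φ e) (α₀ a) := fun a e => by
    rw [hB, hB' (φ e)]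
    rfl
  have hδ0 : ∀ a : A, (a : V) ∈ E → δ a = 0 := fun a ha => by
    ext e
    rw [hδ, ← hα₀E ⟨a, ha⟩ a rfl, hφ]
    simp
  have hδT : ∀ a, δ a ∈ LinearMap.range T := fun a => by
    refine exists_apply_eq_of_forall_eq_zero T _ fun e he => ?_
    obtain ⟨c, hc, hd⟩ := exists_mem_sub_mem_orthogonal hB hEA e.2 fun r hr hro => by
      rw [hB]
      exact he ⟨r, hr, hro⟩
    have he' : e = ⟨c, hc.1⟩ + ⟨e - c, hd.1⟩ := Subtype.ext (add_sub_cancel c (e : V)).symm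
    rw [he', map_add, hδ, hδ, hα₀E ⟨c, hc.1⟩ ⟨c, hc.2⟩ rfl, hα₀, hB (e - c : V) a,
      hB' (φ ⟨e - c, hd.1⟩)]
    have h1 : B a (e - c : V) = 0 := hd.2 _ a.2
    have h2 : B' (α₀ a) (φ ⟨e - c, hd.1⟩) = 0 := hAo _ hd.2 _ (hα₀mem a)
    simp [h1, h2]
  obtain ⟨s, hs⟩ := exists_section_on_range T
  let ρ : A →ₗ[F] R := s ∘ₗ δ
  have hρ : ∀ a (e : E), B (ρ a) e = δ a e := fun a e => by
    have h1 : T (ρ a) = δ a := hs _ (hδT a)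
    exact LinearMap.congr_fun h1 e
  have hρ0 : ∀ a : A, (a : V) ∈ E → ρ a = 0 := fun a ha => by
    change s (δ a) = 0
    rw [hδ0 a ha, map_zero]
  let φR : R →ₗ[F] V' := φ ∘ₗ Submodule.inclusion hRE
  have hφRA : ∀ r, φR r ∈ A' := fun r => hA _ r.2.1
  have hφRo : ∀ r, ∀ x ∈ A', B' x (φR r) = 0 := fun r => hAo _ r.2.2
  let α : A →ₗ[F] V' := α₀ + φR ∘ₗ ρ
  have hα : ∀ a, α a = α₀ a + φR (ρ a) := fun a => rfl
  have hαiso : ∀ x y, B' (α x) (α y) = B x y := fun x y => by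
    simp only [hα, map_add, LinearMap.add_apply, hα₀, hφRo _ _ (hα₀mem x), hφRo _ _ (hφRA _),
      hB' (φR _) (α₀ y), hφRo _ _ (hα₀mem y), add_zero]
  have hαE : ∀ (e : E) (a : A), (e : V) = a → φ e = α a := fun e a hea => by
    rw [hα, hρ0 a (hea ▸ e.2), map_zero, add_zero, hα₀E e a hea]
  refine ⟨α, ?_, fun a => add_mem (hα₀mem a) (hφRA _), hαiso, fun e a => ?_, hαE⟩
  · rw [injective_iff_map_eq_zero]
    intro a ha
    have haE : (a : V) ∈ E := hradE a a.2 fun x hx => by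
      change B x a = 0
      rw [← hαiso ⟨x, hx⟩ a, ha, map_zero]
    have h1 : φ ⟨a, haE⟩ = 0 := (hαE _ a rfl).trans ha
    have h2 : (a : V) = 0 := congrArg Subtype.val ((injective_iff_map_eq_zero φ).1 hinj _ h1)
    exact Subtype.ext h2
  · have h1 : B' (φ e) (φR (ρ a)) = B (ρ a) e := (hφ _ _).trans (hB _ _)
    rw [hα, map_add, h1, hρ, hδ]
    abel

/-- Witt's extension theorem for nonsingular isometric spaces. -/
lemma exists_isometry_extension [FiniteDimensional F V] (hchar : (2 : F) ≠ 0)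
    (hB : ∀ u v, B u v = B v u) (hnd : B.Nondegenerate) (hVV' : AreIsometric B B')
    (D : Submodule F V) (σ : D →ₗ[F] V') (hinj : Function.Injective σ)
    (hσ : ∀ x y, B' (σ x) (σ y) = B x y) :
    ∃ ψ : V ≃ₗ[F] V', IsIsometry B B' ψ ∧ ∀ x : D, ψ x = σ x := by
  obtain ⟨θ, hθ⟩ := hVV'
  have hθs : ∀ x y, B (θ.symm x) (θ.symm y) = B' x y := fun x y => by
    rw [← hθ, θ.apply_symm_apply, θ.apply_symm_apply]
  have hker : ∀ x, B x = 0 → x = 0 := fun x hx => hnd.1 x fun y => by rw [hx]; rfl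
  obtain ⟨g, hg1, hg2, hg3⟩ := exists_isometric_extension hchar hB D
    (fun x hx => by rw [hker x hx]; exact zero_mem D) (θ.symm.toLinearMap ∘ₗ σ)
    (θ.symm.injective.comp hinj) (fun x y => (hθs _ _).trans (hσ x y))
    (fun x hx => by
      rw [show x = 0 from Subtype.ext (hker x hx), map_zero, map_zero])
  refine ⟨(LinearEquiv.ofInjectiveEndo g hg1).trans θ, fun x y => (hθ _ _).trans (hg2 x y),
    fun x => ?_⟩
  change θ (g x) = σ x
  rw [hg3]
  exact θ.apply_symm_apply _

end Auxiliary

end Witt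

/-- Corollary 5.5: if `(E+A^⊥) ∩ A = E ∩ A` and `(E'+A'^⊥) ∩ A' = E' ∩ A'`,
then an isometry `φ : E → E'` extends to an isometry `V → V'` sending `A` to
`A'` iff `φ(E ∩ A) = E' ∩ A'` and `φ(E ∩ A^⊥) = E' ∩ A'^⊥`. -/
theorem witt_extension_subspace_pair_special {F V V' : Type*} [Field F]
    [AddCommGroup V] [Module F V] [AddCommGroup V'] [Module F V']
    [FiniteDimensional F V] [FiniteDimensional F V']
    (hchar : (2 : F) ≠ 0)
    (B : LinearMap.BilinForm F V) (B' : LinearMap.BilinForm F V')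
    (hB : ∀ u v : V, B u v = B v u) (hB' : ∀ u v : V', B' u v = B' v u)
    (hnd : B.Nondegenerate) (hnd' : B'.Nondegenerate)
    (hVV' : AreIsometric B B')
    (E A : Submodule F V) (E' A' : Submodule F V')
    (hAA' : SubIsometric B B' A A')
    (hEA : (E ⊔ B.orthogonal A) ⊓ A = E ⊓ A)
    (hEA' : (E' ⊔ B'.orthogonal A') ⊓ A' = E' ⊓ A')
    (φ : E ≃ₗ[F] E') (hφ : IsIsometryOn B B' E E' φ) :
    (∃ φV : V ≃ₗ[F] V', IsIsometry B B' φV ∧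
        (∀ e : E, φV (e : V) = (φ e : V')) ∧ A.map φV.toLinearMap = A') ↔
      ((∀ e : E, (e : V) ∈ A ↔ (φ e : V') ∈ A') ∧
       (∀ e : E, (e : V) ∈ B.orthogonal A ↔ (φ e : V') ∈ B'.orthogonal A')) := by
  constructor
  · rintro ⟨ψ, hψ, hψE, hψA⟩
    have hmem : ∀ x, x ∈ A ↔ ψ x ∈ A' := fun x => by
      rw [← hψA]
      exact (ψ.injective.mem_set_image (s := A)).symm
    refine ⟨fun e => by rw [← hψE, hmem], fun e => ?_⟩
    rw [← hψE]
    refine ⟨fun h x hx => ?_, fun h x hx => ?_⟩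
    · have h1 : B (ψ.symm x) e = 0 := h _ ((hmem _).2 (by rwa [ψ.apply_symm_apply]))
      change B' x (ψ e) = 0
      rw [← h1, ← hψ, ψ.apply_symm_apply]
    · exact (hψ x e).symm.trans (h _ ((hmem x).1 hx))
  · rintro ⟨hA, hAo⟩
    have hinj : Function.Injective (E'.subtype ∘ₗ φ.toLinearMap) :=
      E'.injective_subtype.comp φ.injective
    obtain ⟨α, hα1, hα2, hα3, hα4, hα5⟩ := exists_compatible_isometry hchar hB hB' hAA' hEA
      (E'.subtype ∘ₗ φ.toLinearMap) hinj hφ (fun e => (hA e).1) (fun e => (hAo e).1)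
    change ∀ (e : E) (a : A), B' (φ e) (α a) = B e a at hα4
    change ∀ (e : E) (a : A), (e : V) = a → (φ e : V') = α a at hα5
    let σ := LinearPMap.sup ⟨E, E'.subtype ∘ₗ φ.toLinearMap⟩ ⟨A, α⟩ hα5
    have hσ : ∀ (e : E) (a : A) (z : σ.domain), (e : V) + a = z → σ z = φ e + α a :=
      fun e a z hz =>
      LinearPMap.sup_apply (f := ⟨E, E'.subtype ∘ₗ φ.toLinearMap⟩) (g := ⟨A, α⟩) hα5 e a z hz
    have hdec : ∀ z : σ.domain, ∃ (e : E) (a : A), (e : V) + a = z := fun z => by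
      obtain ⟨e, he, a, ha, h⟩ := Submodule.mem_sup.1 z.2
      exact ⟨⟨e, he⟩, ⟨a, ha⟩, h⟩
    obtain ⟨ψ, hψ, hψσ⟩ := exists_isometry_extension hchar hB hnd hVV' σ.domain σ.toFun
      (by
        rw [injective_iff_map_eq_zero]
        intro z hz
        obtain ⟨e, a, hea⟩ := hdec z
        have h1 : (φ e : V') + α a = 0 := (hσ e a z hea).symm.trans hz
        have heA : (e : V) ∈ A := by
          rw [hA, eq_neg_of_add_eq_zero_left h1]
          exact neg_mem (hα2 a)
        rw [hα5 e ⟨e, heA⟩ rfl, ← map_add] at h1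
        have h2 := congrArg Subtype.val ((injective_iff_map_eq_zero α).1 hα1 _ h1)
        exact Subtype.ext (hea.symm.trans h2))
      (fun x y => by
        obtain ⟨e, a, hx⟩ := hdec x
        obtain ⟨f, c, hy⟩ := hdec y
        change B' (σ x) (σ y) = _
        rw [hσ e a x hx, hσ f c y hy, ← hx, ← hy]
        simp only [map_add, LinearMap.add_apply, hφ e f, hα3, hα4, hB' (α a) (φ f), hB a f])
    refine ⟨ψ, hψ, fun e => ?_, ?_⟩
    · have h1 := hσ e 0 ⟨e, Submodule.mem_sup_left e.2⟩ (by simp)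
      rw [map_zero, add_zero] at h1
      exact (hψσ ⟨e, Submodule.mem_sup_left e.2⟩).trans h1
    · refine Submodule.eq_of_le_of_finrank_eq ?_ ?_
      · rintro _ ⟨a, ha, rfl⟩
        have h1 := hσ 0 ⟨a, ha⟩ ⟨a, Submodule.mem_sup_right ha⟩ (by simp)
        rw [map_zero, Submodule.coe_zero, zero_add] at h1
        have h2 : ψ a = α ⟨a, ha⟩ := (hψσ ⟨a, Submodule.mem_sup_right ha⟩).trans h1
        change ψ a ∈ A'
        rw [h2]
        exact hα2 _
      · obtain ⟨θ, -⟩ := hAA'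
        rw [← θ.finrank_eq]
        exact LinearEquiv.finrank_map_eq ψ A
end

section
/- Let (V,b) ≈ (V',b') be nonsingular finite-dimensional metric spaces over F, and let 𝒱 = {V_i}_{i=0,…,k} and 𝒱' = {V_i'}_{i=0,…,k} be flags of V and V' respectively. Then there exists an isometry φ_V : V → V' with φ_V(V_i) = V_i' for all i = 0,…,k if and only if V_i ≈ V_i' for i = 0,…,k and dim(V_i^⊥ ∩ V_j) = dim(V_i'^⊥ ∩ V_j') for all 0 < j < i < k. -/
open Module

open Module Witt

namespace Witt

variable {F V V' : Type*} [Field F] [AddCommGroup V] [Module F V]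
  [AddCommGroup V'] [Module F V']

/-- The reflection in an anisotropic vector. -/
theorem exists_reflection (B : LinearMap.BilinForm F V) (hB : ∀ u v : V, B u v = B v u)
    {u : V} (hu : B u u ≠ 0) :
    ∃ τ : V ≃ₗ[F] V, IsIsometry B B τ ∧ ∀ w, τ w = w - (2 * B u w / B u u) • u := by
  let t : V →ₗ[F] V := LinearMap.id - ((2 / B u u) • (B u)).smulRight u
  have ht : ∀ w, t w = w - (2 * B u w / B u u) • u := fun w => by
    simp only [t, LinearMap.sub_apply, LinearMap.id_apply, LinearMap.smulRight_apply,
      LinearMap.smul_apply, smul_eq_mul]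
    congr 2
    ring
  have hinv : Function.Involutive t := fun w => by
    rw [ht (t w), ht w, sub_sub, ← add_smul, sub_eq_self]
    convert zero_smul F u using 2
    simp only [map_sub, map_smul, smul_eq_mul]
    field_simp
    ring
  refine ⟨LinearEquiv.ofInvolutive t hinv, fun v w => ?_, ht⟩
  change B (t v) (t w) = _
  rw [ht, ht]
  simp only [map_sub, map_smul, LinearMap.sub_apply, LinearMap.smul_apply, smul_eq_mul, hB v u]
  field_simp
  ring

/-- Two anisotropic vectors of the same length are exchanged by an isometry which fixes everything
orthogonal to both of them. -/
theorem exists_isometry_apply_eq (hchar : (2 : F) ≠ 0) (B : LinearMap.BilinForm F V)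
    (hB : ∀ u v : V, B u v = B v u) {z y : V} (hzy : B z z = B y y) (hy : B y y ≠ 0) :
    ∃ τ : V ≃ₗ[F] V, IsIsometry B B τ ∧ τ z = y ∧
      ∀ w, B z w = 0 → B y w = 0 → τ w = w := by
  by_cases h : B (z - y) (z - y) = 0
  · have hs : B (z + y) (z + y) ≠ 0 := fun hs => by
      have h4 : (2 * 2) * B y y = 0 := by
        simp only [map_sub, map_add, LinearMap.sub_apply, LinearMap.add_apply] at h hs
        linear_combination h + hs - 2 * hzy
      simp_all
    obtain ⟨σ, hσ, hσa⟩ := exists_reflection B hB hs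
    obtain ⟨ρ, hρ, hρa⟩ := exists_reflection B hB hy
    refine ⟨σ.trans ρ, fun u v => by simp [hρ _ _, hσ _ _], ?_, fun w hz hw => ?_⟩
    · have h1 : σ z = -y := by
        have : 2 * B (z + y) z / B (z + y) (z + y) = 1 := by
          rw [div_eq_one_iff_eq hs]
          simp only [map_add, LinearMap.add_apply, hB y z, hzy]
          ring
        rw [hσa, this]
        module
      have h2 : 2 * B y (-y) / B y y = -2 := by
        simp only [map_neg]
        field_simp
      rw [LinearEquiv.trans_apply, h1, hρa, h2]
      module
    · simp [hσa, hρa, hz, hw]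
  · obtain ⟨σ, hσ, hσa⟩ := exists_reflection B hB h
    refine ⟨σ, hσ, ?_, fun w hz hw => by simp [hσa, hz, hw]⟩
    have : 2 * B (z - y) z / B (z - y) (z - y) = 1 := by
      rw [div_eq_one_iff_eq h]
      simp only [map_sub, LinearMap.sub_apply, hB y z, hzy]
      ring
    rw [hσa, this]
    module

/-- An injective linear map that sends a subspace into one of the same dimension reflects
membership. -/
theorem mem_of_apply_mem [FiniteDimensional F V] [FiniteDimensional F V']
    {f : V →ₗ[F] V'} {S T : Submodule F V} {T' : Submodule F V'}
    (hf : Set.InjOn f S) (hTS : T ≤ S) (hdim : finrank F T = finrank F T')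
    (hT : ∀ v ∈ T, f v ∈ T') {v : V} (hv : v ∈ S) (hfv : f v ∈ T') : v ∈ T := by
  have hle : T.map f ≤ T' := Submodule.map_le_iff_le_comap.2 hT
  have hinj : Function.Injective (f.domRestrict T) := fun a b hab =>
    Subtype.ext (hf (hTS a.2) (hTS b.2) hab)
  have heq : T.map f = T' := by
    apply Submodule.eq_of_le_of_finrank_eq hle
    rw [← hdim, ← LinearMap.range_domRestrict, LinearMap.finrank_range_of_inj hinj]
  obtain ⟨t, ht, htv⟩ := heq ▸ hfv
  exact hf (hTS ht) hv htv ▸ ht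

/-- Linear maps can be prescribed on two independent subspaces. -/
theorem exists_linearMap_eq_of_disjoint {S K : Submodule F V} (h : Disjoint S K)
    (f g : V →ₗ[F] V') :
    ∃ p : V →ₗ[F] V', (∀ v ∈ S, p v = f v) ∧ ∀ v ∈ K, p v = g v := by
  obtain ⟨L, hSL, hL⟩ := h.exists_isCompl
  refine ⟨LinearMap.ofIsCompl hL (f.domRestrict L) (g.domRestrict K), fun v hv => ?_,
    fun v hv => ?_⟩
  · exact LinearMap.ofIsCompl_apply_left hL (⟨v, hSL hv⟩ : L)
  · exact LinearMap.ofIsCompl_apply_right hL (⟨v, hv⟩ : K)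

/-- An isometry defined on the radical extends to the whole space. -/
theorem exists_isometry_eq_on_ker [FiniteDimensional F V] [FiniteDimensional F V']
    (B : LinearMap.BilinForm F V) (B' : LinearMap.BilinForm F V')
    (hB : ∀ u v : V, B u v = B v u) (hB' : ∀ u v : V', B' u v = B' v u)
    (ψ : V ≃ₗ[F] V') (hψ : IsIsometry B B' ψ) (f : V →ₗ[F] V')
    (hf : Set.InjOn f (LinearMap.ker B)) (hR : ∀ v ∈ LinearMap.ker B, f v ∈ LinearMap.ker B') :
    ∃ g : V ≃ₗ[F] V', IsIsometry B B' g ∧ ∀ v ∈ LinearMap.ker B, g v = f v := by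
  obtain ⟨D, hD⟩ := (LinearMap.ker B).exists_isCompl
  obtain ⟨p, hp1, hp2⟩ := exists_linearMap_eq_of_disjoint hD.disjoint f ψ.toLinearMap
  have hdec : ∀ v, ∃ r ∈ LinearMap.ker B, ∃ d ∈ D, r + d = v := fun v =>
    Submodule.mem_sup.1 (hD.sup_eq_top ▸ Submodule.mem_top)
  have hl : ∀ r ∈ LinearMap.ker B, ∀ v, B r v = 0 := fun r hr v => by
    rw [LinearMap.mem_ker.1 hr]; rfl
  have hl' : ∀ r ∈ LinearMap.ker B', ∀ v, B' r v = 0 := fun r hr v => by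
    rw [LinearMap.mem_ker.1 hr]; rfl
  have hinj : Function.Injective p := by
    rw [← LinearMap.ker_eq_bot, LinearMap.ker_eq_bot']
    intro v hv
    obtain ⟨r, hr, d, hd, rfl⟩ := hdec v
    rw [map_add, hp1 r hr, hp2 d hd] at hv
    have hdk : d ∈ LinearMap.ker B := by
      rw [LinearMap.mem_ker]
      ext w
      rw [← hψ d w, show ψ d = -(f r) from eq_neg_of_add_eq_zero_right hv]
      simp [hl' _ (hR r hr)]
    have hd0 : d = 0 := Submodule.disjoint_def.1 hD.disjoint d hdk hd
    subst hd0
    have : r = 0 := hf hr (zero_mem _) (by simpa using hv)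
    simp [this]
  have hdim : finrank F V = finrank F V' := ψ.finrank_eq
  refine ⟨LinearEquiv.ofInjectiveOfFinrankEq p hinj hdim, fun u v => ?_, hp1⟩
  change B' (p u) (p v) = _
  obtain ⟨r, hr, d, hd, rfl⟩ := hdec u
  obtain ⟨s, hs, e, he, rfl⟩ := hdec v
  simp only [map_add, LinearMap.add_apply, hp1 r hr, hp1 s hs, hp2 d hd, hp2 e he,
    hl _ hr, hl' _ (hR r hr), hB _ s, hB' _ (f s), hl _ hs, hl' _ (hR s hs)]
  simpa using hψ d e

/-- Witt extension from a subspace whose radical lies in the radical of the whole space. -/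
theorem exists_isometry_extend_of_radical_le [FiniteDimensional F V] [FiniteDimensional F V']
    (hchar : (2 : F) ≠ 0)
    (B : LinearMap.BilinForm F V) (B' : LinearMap.BilinForm F V')
    (hB : ∀ u v : V, B u v = B v u) (hB' : ∀ u v : V', B' u v = B' v u)
    (ψ : V ≃ₗ[F] V') (hψ : IsIsometry B B' ψ) (f : V →ₗ[F] V')
    (hR : ∀ v ∈ LinearMap.ker B, f v ∈ LinearMap.ker B') (A : Submodule F V)
    (hRA : LinearMap.ker B ≤ A) (hf : Set.InjOn f A)
    (hfA : ∀ u ∈ A, ∀ v ∈ A, B' (f u) (f v) = B u v)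
    (hrad : ∀ x ∈ A, (∀ a ∈ A, B x a = 0) → x ∈ LinearMap.ker B) :
    ∃ g : V ≃ₗ[F] V', IsIsometry B B' g ∧ ∀ v ∈ A, g v = f v := by
  induction hn : finrank F A using Nat.strong_induction_on generalizing A with
  | _ n ih =>
  by_cases hx : ∃ x ∈ A, B x x ≠ 0
  · obtain ⟨x, hxA, hx⟩ := hx
    have hA : ∀ a ∈ A, ∃ b ∈ A ⊓ LinearMap.ker (B x), ∃ c : F, a = b + c • x := fun a ha => by
      refine ⟨a - (B x a / B x x) • x, ⟨A.sub_mem ha (A.smul_mem _ hxA), ?_⟩, B x a / B x x,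
        by simp⟩
      rw [SetLike.mem_coe, LinearMap.mem_ker, map_sub, map_smul, smul_eq_mul,
        div_mul_cancel₀ _ hx, sub_self]
    obtain ⟨g, hg, hgf⟩ := ih (finrank F ↥(A ⊓ LinearMap.ker (B x)))
      (hn ▸ Submodule.finrank_lt_finrank_of_lt (lt_of_le_of_ne inf_le_left fun h =>
        hx (LinearMap.mem_ker.1 (inf_eq_left.1 h hxA))))
      (A ⊓ LinearMap.ker (B x))
      (le_inf hRA fun r hr => by rw [LinearMap.mem_ker, hB, LinearMap.mem_ker.1 hr]; rfl)
      (hf.mono inf_le_left) (fun u hu v hv => hfA u hu.1 v hv.1)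
      (fun z hz hza => hrad z hz.1 fun a ha => by
        obtain ⟨b, hb, c, rfl⟩ := hA a ha
        have := LinearMap.mem_ker.1 hz.2
        simp [hza b hb, hB z x, this]) rfl
    obtain ⟨τ, hτ, hτx, hτw⟩ := exists_isometry_apply_eq hchar B' hB'
      (z := g x) (y := f x) (by rw [hg, hfA x hxA x hxA]) (by rwa [hfA x hxA x hxA])
    refine ⟨g.trans τ, fun u v => by simp [hτ _ _, hg _ _], fun a ha => ?_⟩
    obtain ⟨b, hb, c, rfl⟩ := hA a ha
    have hxb : B x b = 0 := hb.2
    have : τ (f b) = f b := hτw _ (by rw [← hgf b hb, hg, hxb]) (by rw [hfA x hxA b hb.1, hxb])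
    simp [hgf b hb, this, hτx]
  · push Not at hx
    have hiso : ∀ u ∈ A, ∀ v ∈ A, B u v = 0 := fun u hu v hv => by
      have h := hx _ (A.add_mem hu hv)
      simp only [map_add, LinearMap.add_apply, hx u hu, hx v hv, hB v u] at h
      have : 2 * B u v = 0 := by linear_combination h
      simpa [hchar] using this
    obtain rfl : LinearMap.ker B = A := hRA.antisymm fun x hxA => hrad x hxA (hiso x hxA)
    exact exists_isometry_eq_on_ker B B' hB hB' ψ hψ f hf hR

/-- A linear form vanishing on the radical is represented by a vector. -/
theorem exists_apply_eq_of_ker_le [FiniteDimensional F V] (B : LinearMap.BilinForm F V)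
    (l : V →ₗ[F] F) (hl : ∀ v ∈ LinearMap.ker B, l v = 0) : ∃ y, ∀ v, B v y = l v := by
  have h : l ∈ LinearMap.range B.dualMap := by
    rw [LinearMap.range_dualMap_eq_dualAnnihilator_ker, Submodule.mem_dualAnnihilator]
    exact hl
  obtain ⟨m, rfl⟩ := h
  obtain ⟨y, rfl⟩ := (Module.evalEquiv F V).surjective m
  exact ⟨y, fun v => rfl⟩

/-- Witt's extension theorem for a possibly degenerate symmetric form: a partial isometry that is
defined on the radical and preserves it extends to the whole space. -/
theorem exists_isometry_extend [FiniteDimensional F V] [FiniteDimensional F V']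
    (hchar : (2 : F) ≠ 0)
    (B : LinearMap.BilinForm F V) (B' : LinearMap.BilinForm F V')
    (hB : ∀ u v : V, B u v = B v u) (hB' : ∀ u v : V', B' u v = B' v u)
    (ψ : V ≃ₗ[F] V') (hψ : IsIsometry B B' ψ) (f : V →ₗ[F] V')
    (hR : ∀ v ∈ LinearMap.ker B, f v ∈ LinearMap.ker B') (A : Submodule F V)
    (hRA : LinearMap.ker B ≤ A) (hf : Set.InjOn f A)
    (hfA : ∀ u ∈ A, ∀ v ∈ A, B' (f u) (f v) = B u v) :
    ∃ g : V ≃ₗ[F] V', IsIsometry B B' g ∧ ∀ v ∈ A, g v = f v := by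
  induction hn : finrank F V - finrank F A using Nat.strong_induction_on generalizing A f with
  | _ n ih =>
  by_cases hrad : ∀ x ∈ A, (∀ a ∈ A, B x a = 0) → x ∈ LinearMap.ker B
  · exact exists_isometry_extend_of_radical_le hchar B B' hB hB' ψ hψ f hR A hRA hf hfA hrad
  push Not at hrad
  obtain ⟨x, hxA, hxa, hxR⟩ := hrad
  obtain ⟨y, hxy⟩ : ∃ y, B x y ≠ 0 := by
    by_contra! h
    exact hxR (LinearMap.ext h)
  have hyA : y ∉ A := fun h => hxy (hxa y h)
  have hkerdim : finrank F (LinearMap.ker B) = finrank F (LinearMap.ker B') := by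
    have : (LinearMap.ker B).map ψ.toLinearMap = LinearMap.ker B' := by
      ext v
      simp only [Submodule.mem_map, LinearMap.mem_ker, LinearMap.ext_iff, LinearMap.zero_apply]
      constructor
      · rintro ⟨w, hw, rfl⟩ u
        obtain ⟨u, rfl⟩ := ψ.surjective u
        exact (hψ w u).trans (hw u)
      · intro h
        refine ⟨ψ.symm v, fun u => ?_, by simp⟩
        rw [← hψ]
        simpa using h (ψ u)
    rw [← this]
    exact (LinearEquiv.finrank_map_eq ψ _).symm
  obtain ⟨p, hp⟩ := (f.domRestrict A).exists_leftInverse_of_injective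
    (LinearMap.ker_eq_bot.2 fun a b hab => Subtype.ext (hf a.2 b.2 hab))
  have hpa : ∀ a (ha : a ∈ A), p (f a) = ⟨a, ha⟩ := fun a ha => LinearMap.congr_fun hp ⟨a, ha⟩
  have hsurj : ∀ r' ∈ LinearMap.ker B', ∃ r ∈ LinearMap.ker B, f r = r' := by
    have heq : (LinearMap.ker B).map f = LinearMap.ker B' := by
      apply Submodule.eq_of_le_of_finrank_eq (Submodule.map_le_iff_le_comap.2 hR)
      rw [← hkerdim, ← LinearMap.range_domRestrict, LinearMap.finrank_range_of_inj]
      exact fun a b hab => Subtype.ext (hf (hRA a.2) (hRA b.2) hab)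
    intro r' hr'
    rwa [← heq] at hr'
  obtain ⟨y₁, hy₁⟩ := exists_apply_eq_of_ker_le B' (B y ∘ₗ A.subtype ∘ₗ p) (by
    intro r' hr'
    obtain ⟨r, hr, rfl⟩ := hsurj r' hr'
    simp [hpa r (hRA hr), hB y r, LinearMap.mem_ker.1 hr])
  have hy₁A : ∀ a ∈ A, B' (f a) y₁ = B a y := fun a ha => by
    simp [hy₁, hpa a ha, hB y a]
  obtain ⟨y', hy'A, hy'y'⟩ : ∃ y', (∀ a ∈ A, B' (f a) y' = B a y) ∧ B' y' y' = B y y := by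
    refine ⟨y₁ + ((B y y - B' y₁ y₁) / (2 * B x y)) • f x, fun a ha => ?_, ?_⟩
    · rw [map_add, map_smul, hy₁A a ha, hfA a ha x hxA, hB a x, hxa a ha]
      simp
    · simp only [map_add, map_smul, LinearMap.add_apply, LinearMap.smul_apply, smul_eq_mul,
        hy₁A x hxA, hB' y₁ (f x), hfA x hxA x hxA, hxa x hxA]
      field_simp
      ring
  have hdisj : Disjoint A (F ∙ y) := by
    rw [Submodule.disjoint_span_singleton]
    exact fun h => absurd h hyA
  obtain ⟨k, hk⟩ : ∃ k : V →ₗ[F] V', k y = y' := by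
    have hy0 : y ≠ 0 := fun h => hyA (h ▸ A.zero_mem)
    obtain ⟨l, hl⟩ := Module.Projective.exists_dual_ne_zero F hy0
    exact ⟨((l y)⁻¹ • l).smulRight y', by simp [hl]⟩
  obtain ⟨f₂, hf₂A, hf₂y⟩ := exists_linearMap_eq_of_disjoint hdisj f k
  replace hf₂y : f₂ y = y' := (hf₂y y (Submodule.mem_span_singleton_self y)).trans hk
  have hdec : ∀ v ∈ A ⊔ F ∙ y, ∃ a ∈ A, ∃ c : F, v = a + c • y := fun v hv => by
    obtain ⟨a, ha, z, hz, rfl⟩ := Submodule.mem_sup.1 hv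
    obtain ⟨c, rfl⟩ := Submodule.mem_span_singleton.1 hz
    exact ⟨a, ha, c, rfl⟩
  have hlt : A < A ⊔ F ∙ y := lt_of_le_of_ne le_sup_left fun h =>
    hyA (h ▸ Submodule.mem_sup_right (Submodule.mem_span_singleton_self y))
  obtain ⟨g, hg, hgf⟩ := ih (finrank F V - finrank F ↥(A ⊔ F ∙ y))
    (by
      have h1 := Submodule.finrank_lt_finrank_of_lt hlt
      have h2 := Submodule.finrank_le (A ⊔ F ∙ y)
      omega)
    f₂ (fun r hr => hf₂A r (hRA hr) ▸ hR r hr) (A ⊔ F ∙ y) (hRA.trans le_sup_left)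
    (by
      apply LinearMap.injOn_of_disjoint_ker le_rfl
      rw [Submodule.disjoint_def]
      intro v hv hv0
      obtain ⟨a, ha, c, rfl⟩ := hdec v hv
      rw [LinearMap.mem_ker, map_add, map_smul, hf₂A a ha, hf₂y] at hv0
      have hc : c = 0 := by
        have := congrArg (B' (f x)) hv0
        simpa [hfA x hxA a ha, hxa a ha, hy'A x hxA, hxy] using this
      subst hc
      have : a = 0 := hf ha (zero_mem _) (by simpa using hv0)
      simp [this])
    (by
      intro u hu v hv
      obtain ⟨a, ha, c, rfl⟩ := hdec u hu
      obtain ⟨b, hb, d, rfl⟩ := hdec v hv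
      simp only [map_add, map_smul, LinearMap.add_apply, LinearMap.smul_apply, smul_eq_mul,
        hf₂A a ha, hf₂A b hb, hf₂y, hB' y' (f b), hy'A a ha, hy'A b hb, hfA a ha b hb, hy'y',
        hB y b])
    rfl
  exact ⟨g, hg, fun v hv => (hgf v (le_sup_left (a := A) hv)).trans (hf₂A v hv)⟩

/-- Witt extension inside a pair of isometric subspaces. -/
theorem exists_isometry_extend_subspace [FiniteDimensional F V] [FiniteDimensional F V']
    (hchar : (2 : F) ≠ 0)
    (B : LinearMap.BilinForm F V) (B' : LinearMap.BilinForm F V')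
    (hB : ∀ u v : V, B u v = B v u) (hB' : ∀ u v : V', B' u v = B' v u)
    {U A : Submodule F V} {U' : Submodule F V'} (hW : SubIsometric B B' U U') (hAW : A ≤ U)
    (f : V →ₗ[F] V') (hf : Set.InjOn f A) (hfW : ∀ v ∈ A, f v ∈ U')
    (hfA : ∀ u ∈ A, ∀ v ∈ A, B' (f u) (f v) = B u v)
    (hRA : B.orthogonal U ⊓ U ≤ A)
    (hR : ∀ v ∈ B.orthogonal U ⊓ U, f v ∈ B'.orthogonal U') :
    ∃ g : V →ₗ[F] V', (∀ v ∈ A, g v = f v) ∧ Set.InjOn g U ∧ (∀ v ∈ U, g v ∈ U') ∧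
      ∀ u ∈ U, ∀ v ∈ U, B' (g u) (g v) = B u v := by
  obtain ⟨χ, hχ⟩ := hW
  let f₀ : A.comap U.subtype →ₗ[F] U' :=
    ((f ∘ₗ U.subtype).domRestrict (A.comap U.subtype)).codRestrict U' fun v => hfW _ v.2
  obtain ⟨f₁, hf₁⟩ := f₀.exists_extend
  have hf₁A : ∀ w : U, (w : V) ∈ A → (f₁ w : V') = f w := fun w hw =>
    congrArg Subtype.val (LinearMap.congr_fun hf₁ (⟨w, hw⟩ : A.comap U.subtype))
  have hker : ∀ w : U, w ∈ LinearMap.ker (B.restrict U) → (w : V) ∈ B.orthogonal U ⊓ U := by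
    refine fun w hw => ⟨fun u hu => ?_, w.2⟩
    have := LinearMap.congr_fun (LinearMap.mem_ker.1 hw) ⟨u, hu⟩
    exact (hB u w).trans this
  obtain ⟨g, hg, hgA⟩ := exists_isometry_extend hchar (B.restrict U) (B'.restrict U')
    (fun u v => hB u v) (fun u v => hB' u v) χ hχ f₁
    (by
      intro w hw
      have hw' := hker w hw
      have h := hR w hw'
      rw [LinearMap.mem_ker]
      ext u
      change B' (f₁ w) u = 0
      rw [hf₁A w (hRA hw'), hB']
      exact h u u.2)
    (A.comap U.subtype) (fun w hw => hRA (hker w hw))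
    (by
      intro u hu v hv huv
      refine Subtype.ext (hf hu hv ?_)
      change f u = f v
      rw [← hf₁A u hu, ← hf₁A v hv, huv])
    (by
      intro u hu v hv
      change B' (f₁ u) (f₁ v) = B u v
      rw [hf₁A u hu, hf₁A v hv, hfA u hu v hv])
  obtain ⟨G, hG⟩ := (U'.subtype ∘ₗ g.toLinearMap).exists_extend
  have hGW : ∀ v (hv : v ∈ U), G v = g ⟨v, hv⟩ := fun v hv => LinearMap.congr_fun hG ⟨v, hv⟩
  refine ⟨G, fun v hv => ?_, fun u hu v hv huv => ?_, fun v hv => ?_, fun u hu v hv => ?_⟩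
  · rw [hGW v (hAW hv), hgA ⟨v, hAW hv⟩ hv, hf₁A ⟨v, hAW hv⟩ hv]
  · rw [hGW u hu, hGW v hv] at huv
    exact congrArg Subtype.val (g.injective (Subtype.ext huv))
  · rw [hGW v hv]
    exact (g ⟨v, hv⟩).2
  · rw [hGW u hu, hGW v hv]
    exact hg ⟨u, hu⟩ ⟨v, hv⟩

/-- A linear map injective on `S` can be modified outside `S` so that it becomes injective on
`S ⊔ T` and sends `T` into `T'`. -/
theorem exists_injOn_sup [FiniteDimensional F V] [FiniteDimensional F V']
    {S T : Submodule F V} {T' : Submodule F V'} (f : V →ₗ[F] V') (hf : Set.InjOn f S)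
    (hdim : finrank F T = finrank F T') (hfT : ∀ v ∈ S, f v ∈ T' ↔ v ∈ T) :
    ∃ g : V →ₗ[F] V', (∀ v ∈ S, g v = f v) ∧ Set.InjOn g (S ⊔ T : Submodule F V) ∧
      ∀ v ∈ T, g v ∈ T' := by
  obtain ⟨K, hK⟩ := ((S ⊓ T).comap T.subtype).exists_isCompl
  have hle : (S ⊓ T).map f ≤ T' :=
    Submodule.map_le_iff_le_comap.2 fun v hv => (hfT v hv.1).2 hv.2
  obtain ⟨K', hK'⟩ := (((S ⊓ T).map f).comap T'.subtype).exists_isCompl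
  have e : K ≃ₗ[F] K' := by
    apply LinearEquiv.ofFinrankEq
    have h1 := Submodule.finrank_add_eq_of_isCompl hK
    have h2 := Submodule.finrank_add_eq_of_isCompl hK'
    have h3 : finrank F ((S ⊓ T).comap T.subtype) = finrank F ↥(S ⊓ T) :=
      (Submodule.comapSubtypeEquivOfLe inf_le_right).finrank_eq
    have h4 : finrank F (((S ⊓ T).map f).comap T'.subtype) = finrank F ((S ⊓ T).map f) :=
      (Submodule.comapSubtypeEquivOfLe hle).finrank_eq
    have h5 : finrank F ((S ⊓ T).map f) = finrank F ↥(S ⊓ T) := by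
      rw [← LinearMap.range_domRestrict, LinearMap.finrank_range_of_inj]
      exact fun a b hab => Subtype.ext (hf a.2.1 b.2.1 hab)
    omega
  have hdisj : Disjoint S (K.map T.subtype) := by
    rw [Submodule.disjoint_def]
    rintro _ hvS ⟨v, hvK, rfl⟩
    have := Submodule.disjoint_def.1 hK.disjoint v ⟨hvS, v.2⟩ hvK
    simp [this]
  have hdec : ∀ t ∈ T, ∃ s ∈ S ⊓ T, ∃ k : K, s + (k : T) = t := fun t ht => by
    obtain ⟨s, hs, k, hk, h⟩ := Submodule.mem_sup.1
      (hK.sup_eq_top ▸ Submodule.mem_top : (⟨t, ht⟩ : T) ∈ _ ⊔ K)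
    exact ⟨s, hs, ⟨k, hk⟩, congrArg Subtype.val h⟩
  obtain ⟨m₁, hm₁⟩ := (K'.subtype ∘ₗ e.toLinearMap).exists_extend
  obtain ⟨m, hm⟩ := (T'.subtype ∘ₗ m₁).exists_extend
  have hmK : ∀ k : K, m (k : T) = (e k : T') := fun k => by
    have h1 : m (k : T) = m₁ k := LinearMap.congr_fun hm (k : T)
    have h2 : m₁ k = e k := LinearMap.congr_fun hm₁ k
    rw [h1, h2]
  obtain ⟨g, hgS, hgK⟩ := exists_linearMap_eq_of_disjoint hdisj f m
  replace hgK : ∀ k : K, g (k : T) = (e k : T') := fun k =>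
    (hgK _ ⟨k, k.2, rfl⟩).trans (hmK k)
  refine ⟨g, hgS, ?_, fun t ht => ?_⟩
  · apply LinearMap.injOn_of_disjoint_ker le_rfl
    rw [Submodule.disjoint_def]
    intro v hv hv0
    obtain ⟨s, hs, t, ht, rfl⟩ := Submodule.mem_sup.1 hv
    obtain ⟨u, hu, k, rfl⟩ := hdec t ht
    rw [← add_assoc] at hv0 ⊢
    have hsu := S.add_mem hs hu.1
    generalize s + u = w at hv0 hsu
    rw [LinearMap.mem_ker, map_add, hgS w hsu, hgK k] at hv0
    have hfw : f w = -((e k : T') : V') := eq_neg_of_add_eq_zero_left hv0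
    have hwT : w ∈ T := (hfT w hsu).1 (hfw ▸ T'.neg_mem (e k : T').2)
    have hek : (e k : T') = 0 := by
      refine Submodule.disjoint_def.1 hK'.disjoint _ ⟨-w, ⟨S.neg_mem hsu, T.neg_mem hwT⟩, ?_⟩
        (e k).2
      simp [hfw]
    have hk : k = 0 := by simpa using hek
    subst hk
    have : w = 0 := hf hsu (zero_mem _) (by simpa using hfw)
    simp [this]
  · obtain ⟨s, hs, k, rfl⟩ := hdec t ht
    rw [map_add, hgS s hs.1, hgK k]
    exact T'.add_mem ((hfT s hs.1).2 hs.2) (e k : T').2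

/-- A linear map injective on `A` can be extended compatibly with an increasing chain of
subspaces. -/
theorem exists_injOn_sup_chain [FiniteDimensional F V] [FiniteDimensional F V']
    {A : Submodule F V} (f : V →ₗ[F] V') (hf : Set.InjOn f A)
    (T : ℕ → Submodule F V) (T' : ℕ → Submodule F V') (hT : Monotone T) (hT' : Monotone T')
    (n : ℕ) (hdim : ∀ i ≤ n, finrank F (T i) = finrank F (T' i))
    (hfT : ∀ i ≤ n, ∀ v ∈ A, f v ∈ T' i ↔ v ∈ T i) :
    ∃ g : V →ₗ[F] V', (∀ v ∈ A, g v = f v) ∧ Set.InjOn g (A ⊔ T n : Submodule F V) ∧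
      ∀ i ≤ n, ∀ v ∈ T i, g v ∈ T' i := by
  induction n with
  | zero =>
    obtain ⟨g, hg, hgi, hgT⟩ := exists_injOn_sup f hf (hdim 0 le_rfl) (hfT 0 le_rfl)
    refine ⟨g, hg, hgi, fun i hi => ?_⟩
    obtain rfl : i = 0 := by omega
    exact hgT
  | succ n ih =>
    obtain ⟨g, hg, hgi, hgT⟩ := ih (fun i hi => hdim i (by omega)) fun i hi => hfT i (by omega)
    obtain ⟨h, hh, hhi, hhT⟩ := exists_injOn_sup (T := T (n + 1)) (T' := T' (n + 1)) g hgi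
      (hdim _ le_rfl) (by
        intro v hv
        obtain ⟨a, ha, t, ht, rfl⟩ := Submodule.mem_sup.1 hv
        rw [map_add, hg a ha, Submodule.add_mem_iff_left _ (hT' n.le_succ (hgT n le_rfl t ht)),
          Submodule.add_mem_iff_left _ (hT n.le_succ ht)]
        exact hfT _ le_rfl a ha)
    have hsup : A ⊔ T (n + 1) ≤ A ⊔ T n ⊔ T (n + 1) := sup_le_sup_right le_sup_left _
    refine ⟨h, fun v hv => (hh v (Submodule.mem_sup_left hv)).trans (hg v hv), hhi.mono hsup,
      fun i hi v hv => ?_⟩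
    rcases hi.lt_or_eq with hi | rfl
    · rw [hh v (Submodule.mem_sup_right (hT (by omega : i ≤ n) hv))]
      exact hgT i (by omega) v hv
    · exact hhT v hv

/-- An isometry of whole spaces matches the intersections of subspaces with orthogonal
complements. -/
theorem finrank_orthogonal_inf_map (B : LinearMap.BilinForm F V) (B' : LinearMap.BilinForm F V')
    (φ : V ≃ₗ[F] V') (hφ : IsIsometry B B' φ) (X Y : Submodule F V) :
    finrank F ↥(B.orthogonal X ⊓ Y) =
      finrank F ↥(B'.orthogonal (X.map φ.toLinearMap) ⊓ Y.map φ.toLinearMap) := by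
  have h : (B.orthogonal X ⊓ Y).map φ.toLinearMap =
      B'.orthogonal (X.map φ.toLinearMap) ⊓ Y.map φ.toLinearMap := by
    rw [Submodule.map_inf _ φ.injective]
    congr 1
    ext v
    obtain ⟨v, rfl⟩ := φ.surjective v
    rw [LinearMap.BilinForm.mem_orthogonal_iff]
    constructor
    · rintro ⟨w, hw, hwv⟩ _ ⟨u, hu, rfl⟩
      obtain rfl := φ.injective hwv
      exact (hφ u w).trans (hw u hu)
    · exact fun hv => ⟨v, fun u hu => (hφ u v).symm.trans (hv _ ⟨u, hu, rfl⟩), rfl⟩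
  rw [← h]
  exact (LinearEquiv.finrank_map_eq φ _).symm

/-- The radical of a subspace is the radical of the restricted form. -/
theorem map_subtype_orthogonal_restrict_top (B : LinearMap.BilinForm F V) (N : Submodule F V) :
    ((B.restrict N).orthogonal ⊤ ⊓ ⊤).map N.subtype = B.orthogonal N ⊓ N := by
  ext v
  simp only [Submodule.mem_map, Submodule.mem_inf, LinearMap.BilinForm.mem_orthogonal_iff]
  constructor
  · rintro ⟨w, ⟨hw, -⟩, rfl⟩
    exact ⟨fun u hu => hw ⟨u, hu⟩ trivial, w.2⟩
  · rintro ⟨hv, hvN⟩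
    exact ⟨⟨v, hvN⟩, ⟨fun u _ => hv u u.2, trivial⟩, rfl⟩

/-- Isometric subspaces have radicals of the same dimension. -/
theorem SubIsometric.finrank_radical_eq {B : LinearMap.BilinForm F V}
    {B' : LinearMap.BilinForm F V'} {U : Submodule F V} {U' : Submodule F V'}
    (h : SubIsometric B B' U U') :
    finrank F ↥(B.orthogonal U ⊓ U) = finrank F ↥(B'.orthogonal U' ⊓ U') := by
  obtain ⟨χ, hχ⟩ := h
  have key := finrank_orthogonal_inf_map (B.restrict U) (B'.restrict U') χ hχ ⊤ ⊤
  rw [← map_subtype_orthogonal_restrict_top B U,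
    ← map_subtype_orthogonal_restrict_top B' U', Submodule.finrank_map_subtype_eq,
    Submodule.finrank_map_subtype_eq,
    key, Submodule.map_top, LinearMap.range_eq_top.2 χ.surjective]

/-- Partial isometries along two flags with isometric members and matching radicals. -/
theorem exists_partial_isometry_of_flags [FiniteDimensional F V] [FiniteDimensional F V']
    (hchar : (2 : F) ≠ 0)
    (B : LinearMap.BilinForm F V) (B' : LinearMap.BilinForm F V')
    (hB : ∀ u v : V, B u v = B v u) (hB' : ∀ u v : V', B' u v = B' v u)
    (k : ℕ) (𝒱 : ℕ → Submodule F V) (𝒱' : ℕ → Submodule F V') (h0 : 𝒱 0 = ⊥)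
    (hmono : ∀ i j, i ≤ j → j ≤ k → 𝒱 i ≤ 𝒱 j)
    (hmono' : ∀ i j, i ≤ j → j ≤ k → 𝒱' i ≤ 𝒱' j)
    (hiso : ∀ i ≤ k, SubIsometric B B' (𝒱 i) (𝒱' i))
    (hdim : ∀ i j, j ≤ i → i ≤ k → finrank F ↥(B.orthogonal (𝒱 i) ⊓ 𝒱 j) =
      finrank F ↥(B'.orthogonal (𝒱' i) ⊓ 𝒱' j)) (m : ℕ) (hm : m ≤ k) :
    ∃ f : V →ₗ[F] V', Set.InjOn f (𝒱 m) ∧ (∀ u ∈ 𝒱 m, ∀ v ∈ 𝒱 m, B' (f u) (f v) = B u v) ∧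
      (∀ i ≤ m, ∀ v ∈ 𝒱 i, f v ∈ 𝒱' i) ∧
      ∀ i, m ≤ i → i ≤ k → ∀ v ∈ B.orthogonal (𝒱 i) ⊓ 𝒱 m, f v ∈ B'.orthogonal (𝒱' i) := by
  induction m with
  | zero =>
    refine ⟨0, ?_, ?_, fun _ _ _ _ => Submodule.zero_mem _, fun _ _ _ _ _ => Submodule.zero_mem _⟩
    · rw [h0]
      intro u hu v hv _
      rw [(Submodule.mem_bot F).1 hu, (Submodule.mem_bot F).1 hv]
    · rw [h0]
      intro u hu v _
      rw [(Submodule.mem_bot F).1 hu]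
      simp
  | succ m ih =>
    obtain ⟨f, hf, hfB, hfV, hfR⟩ := ih (by omega)
    have hle := hmono m (m + 1) m.le_succ hm
    have hle' := hmono' m (m + 1) m.le_succ hm
    let T : ℕ → Submodule F V := fun i => B.orthogonal (𝒱 (k - i)) ⊓ 𝒱 (m + 1)
    let T' : ℕ → Submodule F V' := fun i => B'.orthogonal (𝒱' (k - i)) ⊓ 𝒱' (m + 1)
    obtain ⟨g, hgf, hg, hgT⟩ := exists_injOn_sup_chain f hf T T'
      (fun i j hij => inf_le_inf_right _
        (LinearMap.BilinForm.orthogonal_le (hmono _ _ (by omega) (by omega))))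
      (fun i j hij => inf_le_inf_right _
        (LinearMap.BilinForm.orthogonal_le (hmono' _ _ (by omega) (by omega))))
      (k - (m + 1)) (fun i hi => hdim _ _ (by omega) (by omega))
      (by
        refine fun i hi v hv => ⟨fun h => ⟨?_, hle hv⟩, fun h =>
          ⟨hfR _ (by omega) (by omega) v ⟨h.1, hv⟩, hle' (hfV m le_rfl v hv)⟩⟩
        exact (mem_of_apply_mem (T := B.orthogonal (𝒱 (k - i)) ⊓ 𝒱 m)
          (T' := B'.orthogonal (𝒱' (k - i)) ⊓ 𝒱' m) hf inf_le_right
          (hdim _ _ (by omega) (by omega))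
          (fun w hw => ⟨hfR _ (by omega) (by omega) w hw, hfV m le_rfl w hw.2⟩) hv
          ⟨h.1, hfV m le_rfl v hv⟩).1)
    have hTn : T (k - (m + 1)) = B.orthogonal (𝒱 (m + 1)) ⊓ 𝒱 (m + 1) := by
      simp only [T, Nat.sub_sub_self hm]
    have hTn' : T' (k - (m + 1)) = B'.orthogonal (𝒱' (m + 1)) ⊓ 𝒱' (m + 1) := by
      simp only [T', Nat.sub_sub_self hm]
    rw [hTn] at hg
    have hgR : ∀ v ∈ B.orthogonal (𝒱 (m + 1)) ⊓ 𝒱 (m + 1),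
        g v ∈ B'.orthogonal (𝒱' (m + 1)) ⊓ 𝒱' (m + 1) := by
      rw [← hTn, ← hTn']
      exact hgT _ le_rfl
    obtain ⟨h, hhg, hh, hhV, hhB⟩ := exists_isometry_extend_subspace hchar B B' hB hB'
      (hiso (m + 1) hm) (sup_le hle inf_le_right) g hg
      (by
        intro v hv
        obtain ⟨a, ha, r, hr, rfl⟩ := Submodule.mem_sup.1 hv
        rw [map_add, hgf a ha]
        exact Submodule.add_mem _ (hle' (hfV m le_rfl a ha)) (hgR r hr).2)
      (by
        have hl : ∀ r ∈ B.orthogonal (𝒱 (m + 1)) ⊓ 𝒱 (m + 1), ∀ v ∈ 𝒱 (m + 1), B v r = 0 :=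
          fun r hr v hv => hr.1 v hv
        have hl' : ∀ r ∈ B.orthogonal (𝒱 (m + 1)) ⊓ 𝒱 (m + 1), ∀ v ∈ 𝒱' (m + 1),
            B' v (g r) = 0 := fun r hr v hv => (hgR r hr).1 v hv
        intro u hu v hv
        obtain ⟨a, ha, r, hr, rfl⟩ := Submodule.mem_sup.1 hu
        obtain ⟨b, hb, s, hs, rfl⟩ := Submodule.mem_sup.1 hv
        have hfa := hle' (hfV m le_rfl a ha)
        have hfb := hle' (hfV m le_rfl b hb)
        simp only [map_add, LinearMap.add_apply, hgf a ha, hgf b hb, hfB a ha b hb,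
          hB r, hB' (g r), hl r hr _ (hle hb), hl s hs _ (hle ha), hl' r hr _ hfb,
          hl' s hs _ hfa, hl r hr s hs.2, hl' r hr _ (hgR s hs).2])
      le_sup_right (fun v hv => (hgR v hv).1)
    refine ⟨h, hh, hhB, fun i hi v hv => ?_, fun i hi hik v hv => ?_⟩
    · rcases hi.lt_or_eq with hi | rfl
      · have hvm := hmono i m (by omega) (by omega) hv
        rw [hhg v (Submodule.mem_sup_left hvm), hgf v hvm]
        exact hfV i (by omega) v hv
      · exact hhV v hv
    · have hvR : v ∈ B.orthogonal (𝒱 (m + 1)) ⊓ 𝒱 (m + 1) :=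
        ⟨LinearMap.BilinForm.orthogonal_le (hmono _ _ hi hik) hv.1, hv.2⟩
      rw [hhg v (Submodule.mem_sup_right hvR)]
      have := hgT (k - i) (by omega) v
      simp only [T, T', Nat.sub_sub_self hik] at this
      exact (this hv).1

end Witt

/-- Theorem 6.1: two generic flags `𝒱` of `V` and `𝒱'` of `V'` are isometric
iff `V_i ≈ V_i'` for all `i` and `dim(V_i^⊥ ∩ V_j) = dim(V_i'^⊥ ∩ V_j')` for
all `0 < j < i < k`. -/
theorem witt_generic_flags_isometric_iff {F V V' : Type*} [Field F]
    [AddCommGroup V] [Module F V] [AddCommGroup V'] [Module F V']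
    [FiniteDimensional F V] [FiniteDimensional F V']
    (hchar : (2 : F) ≠ 0)
    (B : LinearMap.BilinForm F V) (B' : LinearMap.BilinForm F V')
    (hB : ∀ u v : V, B u v = B v u) (hB' : ∀ u v : V', B' u v = B' v u)
    (hnd : B.Nondegenerate) (hnd' : B'.Nondegenerate)
    (hVV' : AreIsometric B B')
    (k : ℕ) (𝒱 : ℕ → Submodule F V) (𝒱' : ℕ → Submodule F V')
    (h0 : 𝒱 0 = ⊥) (hk : 𝒱 k = ⊤) (hmono : ∀ i < k, 𝒱 i ≤ 𝒱 (i + 1))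
    (h0' : 𝒱' 0 = ⊥) (hk' : 𝒱' k = ⊤) (hmono' : ∀ i < k, 𝒱' i ≤ 𝒱' (i + 1)) :
    (∃ φV : V ≃ₗ[F] V', IsIsometry B B' φV ∧
        ∀ i ≤ k, (𝒱 i).map φV.toLinearMap = 𝒱' i) ↔
      ((∀ i ≤ k, SubIsometric B B' (𝒱 i) (𝒱' i)) ∧
       (∀ i j : ℕ, 0 < j → j < i → i < k →
         finrank F ↥(B.orthogonal (𝒱 i) ⊓ 𝒱 j) =
           finrank F ↥(B'.orthogonal (𝒱' i) ⊓ 𝒱' j))) := by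

  have hmono₂ : ∀ i j, i ≤ j → j ≤ k → 𝒱 i ≤ 𝒱 j := fun i j hij => by
    induction j, hij using Nat.le_induction with
    | base => exact fun _ => le_rfl
    | succ j _ ih => exact fun hj => (ih (by omega)).trans (hmono j hj)
  have hmono₂' : ∀ i j, i ≤ j → j ≤ k → 𝒱' i ≤ 𝒱' j := fun i j hij => by
    induction j, hij using Nat.le_induction with
    | base => exact fun _ => le_rfl
    | succ j _ ih => exact fun hj => (ih (by omega)).trans (hmono' j hj)
  constructor
  · rintro ⟨φ, hφ, hφV⟩
    refine ⟨fun i hi => ?_, fun i j _ hji hik => ?_⟩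
    · rw [← hφV i hi]
      exact ⟨φ.submoduleMap (𝒱 i), fun u v => hφ u v⟩
    · rw [← hφV i hik.le, ← hφV j (hji.trans hik).le]
      exact finrank_orthogonal_inf_map B B' φ hφ _ _
  · rintro ⟨hiso, hdim⟩
    obtain ⟨f, hf, hfB, hfV, -⟩ := exists_partial_isometry_of_flags hchar B B' hB hB' k 𝒱 𝒱' h0
      hmono₂ hmono₂' hiso (by
        intro i j hji hik
        rcases Nat.eq_zero_or_pos j with rfl | hj
        · rw [h0, h0', inf_bot_eq, inf_bot_eq, finrank_bot, finrank_bot]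
        rcases hji.eq_or_lt with rfl | hji
        · exact (hiso j hik).finrank_radical_eq
        rcases hik.eq_or_lt with rfl | hik
        · rw [hk, hk', LinearMap.BilinForm.orthogonal_top_eq_bot hnd,
            LinearMap.BilinForm.orthogonal_top_eq_bot hnd', bot_inf_eq, bot_inf_eq,
            finrank_bot, finrank_bot]
        exact hdim i j hj hji hik) k le_rfl
    rw [hk] at hf hfB
    obtain ⟨ψ, -⟩ := hVV'
    have hinj : Function.Injective f := Set.injOn_univ.1 hf
    let φ : V ≃ₗ[F] V' := LinearEquiv.ofInjectiveOfFinrankEq f hinj ψ.finrank_eq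
    refine ⟨φ, fun u v => hfB u trivial v trivial, fun i hi => ?_⟩
    apply Submodule.eq_of_le_of_finrank_eq
      (Submodule.map_le_iff_le_comap.2 fun v hv => hfV i hi v hv)
    obtain ⟨χ, -⟩ := hiso i hi
    exact (LinearEquiv.finrank_map_eq φ _).trans χ.finrank_eq
end
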